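/- arXiv:2312.05564 — 2 statements merged into one kernel-verified Lean document; each statement's English description precedes it below -/
import Mathlib

section
/- Let G be a finite connected simple graph with minimum degree at least 2 and maximum degree Δ, and let ↔G be the symmetric digraph obtained from G by replacing each edge by two opposite arcs. Then ↔G has a majority arc coloring with ⌈Δ^{1/4}⌉ + 4 colors which is distinguishing, meaning that the only automorphism φ of G satisfying c(φ(u),φ(v)) = c(u,v) for every arc (u,v) of ↔G is the identity; that is, M'_D(↔G) ≤ ⌈Δ^{1/4}⌉ + 4. -/
open SimpleGraph

namespace MDC
open Finset

section node
variable {K : ℕ}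

/-- colors saturated in the multiset `M` for a vertex of degree `d` -/
def satF (d : ℕ) (M : Multiset (Fin K)) : Finset (Fin K) :=
  univ.filter (fun α => d < 2 * (α ::ₘ M).count α)

lemma mem_satF {d : ℕ} {M : Multiset (Fin K)} {α : Fin K} :
    α ∈ satF d M ↔ d < 2 * (M.count α + 1) := by
  simp [satF]

lemma sum_count_le (M : Multiset (Fin K)) (s : Finset (Fin K)) :
    ∑ α ∈ s, M.count α ≤ M.card := by
  calc ∑ α ∈ s, M.count α ≤ ∑ α, M.count α :=
        Finset.sum_le_sum_of_subset (Finset.subset_univ s)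
    _ = M.card := Multiset.sum_count_eq_card (fun a _ => Finset.mem_univ a)

lemma satF_mul (d : ℕ) (M : Multiset (Fin K)) :
    (satF d M).card * (d - 1) ≤ 2 * M.card := by
  calc (satF d M).card * (d - 1) = ∑ α ∈ satF d M, (d - 1) := by simp
    _ ≤ ∑ α ∈ satF d M, 2 * M.count α := by
        apply Finset.sum_le_sum
        intro α hα
        rw [mem_satF] at hα
        omega
    _ = 2 * ∑ α ∈ satF d M, M.count α := by rw [Finset.mul_sum]
    _ ≤ 2 * M.card := by
        have := sum_count_le M (satF d M)
        omega

lemma satF_card_le_two {d : ℕ} {M : Multiset (Fin K)} (hd : 2 ≤ d) (h : M.card + 1 ≤ d) :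
    (satF d M).card ≤ 2 := by
  have := satF_mul d M
  by_contra hc
  have h3 : 3 ≤ (satF d M).card := by omega
  have : 3 * (d - 1) ≤ (satF d M).card * (d - 1) := Nat.mul_le_mul_right _ h3
  omega

lemma satF_card_le_one {d : ℕ} {M : Multiset (Fin K)} (h : M.card + 2 ≤ d) :
    (satF d M).card ≤ 1 := by
  have := satF_mul d M
  by_contra hc
  have h3 : 2 ≤ (satF d M).card := by omega
  have : 2 * (d - 1) ≤ (satF d M).card * (d - 1) := Nat.mul_le_mul_right _ h3
  omega

/-- colors forbidden, either saturated or completing the multiset to the forbidden one `P` -/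
def forbF (d : ℕ) (q : Prop) [Decidable q] (P M : Multiset (Fin K)) : Finset (Fin K) :=
  univ.filter (fun α => d < 2 * (α ::ₘ M).count α ∨ (q ∧ α ::ₘ M = P))

lemma mem_forbF {d : ℕ} {q : Prop} [Decidable q] {P M : Multiset (Fin K)} {α : Fin K} :
    α ∈ forbF d q P M ↔ d < 2 * (α ::ₘ M).count α ∨ (q ∧ α ::ₘ M = P) := by
  simp [forbF]

lemma compl_card_le_one (P M : Multiset (Fin K)) :
    (univ.filter (fun α => α ::ₘ M = P)).card ≤ 1 := by
  rw [Finset.card_le_one]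
  intro a ha b hb
  simp only [mem_filter, mem_univ, true_and] at ha hb
  rw [← hb] at ha
  exact (Multiset.cons_inj_left M).1 ha

lemma forbF_sub (d : ℕ) (q : Prop) [Decidable q] (P M : Multiset (Fin K)) :
    forbF d q P M ⊆ satF d M ∪ univ.filter (fun α => α ::ₘ M = P) := by
  intro α hα
  rw [mem_forbF] at hα
  simp only [mem_union, satF, mem_filter, mem_univ, true_and]
  tauto

lemma forbF_card_le_three {d : ℕ} {q : Prop} [Decidable q] {P M : Multiset (Fin K)}
    (hd : 2 ≤ d) (h : M.card + 1 ≤ d) : (forbF d q P M).card ≤ 3 := by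
  have h1 := Finset.card_le_card (forbF_sub d q P M)
  have h2 := Finset.card_union_le (satF d M) (univ.filter (fun α => α ::ₘ M = P))
  have h3 := compl_card_le_one P M
  have h4 := satF_card_le_two hd h
  omega

lemma forbF_card_le_two {d : ℕ} {q : Prop} [Decidable q] {P M : Multiset (Fin K)}
    (hd : 2 ≤ d) (h : M.card + 1 ≤ d) (hP : q → ∀ α, 2 * P.count α + 2 ≤ d) :
    (forbF d q P M).card ≤ 2 := by
  by_cases hq : q ∧ ∃ β, β ::ₘ M = P
  · obtain ⟨hq, β, hβ⟩ := hq
    have hsub : forbF d q P M ⊆ univ.filter (fun α => α ::ₘ M = P) := by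
      intro α hα
      rw [mem_forbF] at hα
      simp only [mem_filter, mem_univ, true_and]
      rcases hα with hα | hα
      · exfalso
        have h1 := hP hq α
        have h2 : M.count α ≤ P.count α := by
          rw [← hβ]; exact Multiset.count_le_count_cons _ _ _
        rw [Multiset.count_cons_self] at hα
        omega
      · exact hα.2
    have := Finset.card_le_card hsub
    have h3 := compl_card_le_one P M
    omega
  · have hsub : forbF d q P M ⊆ satF d M := by
      intro α hα
      rw [mem_forbF] at hα
      simp only [satF, mem_filter, mem_univ, true_and]
      rcases hα with hα | hα
      · exact hα
      · exact absurd ⟨hα.1, α, hα.2⟩ hq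
    exact (Finset.card_le_card hsub).trans (satF_card_le_two hd h)

lemma forbF_card_le_one {d : ℕ} {q : Prop} [Decidable q] {P M : Multiset (Fin K)}
    (h : M.card + 2 ≤ d) (hP : q → P.card = d) :
    (forbF d q P M).card ≤ 1 := by
  have hsub : forbF d q P M ⊆ satF d M := by
    intro α hα
    rw [mem_forbF] at hα
    simp only [satF, mem_filter, mem_univ, true_and]
    rcases hα with hα | hα
    · exact hα
    · exfalso
      have h1 := hP hα.1
      rw [← hα.2, Multiset.card_cons] at h1
      omega
  exact (Finset.card_le_card hsub).trans (satF_card_le_one h)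

end node

section pick

/-- counting lemma used to pick the colors of the two edges owned by a vertex -/
lemma pick {β γ W : Type*} [DecidableEq β] [DecidableEq γ] [DecidableEq W]
    (B : Finset β) (A : β → Finset γ) (n : ℕ) (hA : ∀ b ∈ B, n ≤ (A b).card)
    (R : Finset W) (bad : W → β → Prop) (hbad : ∀ w b b', bad w b → bad w b' → b = b')
    (lab : W → γ) (hR : R.card < B.card * n) :
    ∃ b ∈ B, ∃ a ∈ A b, ∀ w ∈ R, bad w b → lab w ≠ a := by
  by_contra hcon
  push Not at hcon
  have hcon' : ∀ x : (Σ _ : β, γ), x ∈ B.sigma A → ∃ w ∈ R, bad w x.1 ∧ lab w = x.2 := by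
    intro x hx
    rw [Finset.mem_sigma] at hx
    exact hcon x.1 hx.1 x.2 hx.2
  have hne : Nonempty W := by
    by_contra hW
    rw [not_nonempty_iff] at hW
    have hB : 0 < B.card * n := by omega
    have hB1 : 0 < B.card := Nat.pos_of_mul_pos_right hB
    have hn : 0 < n := Nat.pos_of_mul_pos_left hB
    obtain ⟨b, hb⟩ := Finset.card_pos.1 hB1
    obtain ⟨a, ha⟩ := Finset.card_pos.1 (lt_of_lt_of_le hn (hA b hb))
    obtain ⟨w, -⟩ := hcon b hb a ha
    exact hW.elim w
  choose! f hf using hcon'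
  have hcard : (B.sigma A).card ≤ R.card := by
    apply Finset.card_le_card_of_injOn f
    · intro x hx
      exact (hf x hx).1
    · intro x hx y hy hxy
      have h1 := (hf x hx).2
      have h2 := (hf y hy).2
      rw [hxy] at h1
      have e1 := hbad _ _ _ h1.1 h2.1
      have e2 : x.2 = y.2 := h1.2.symm.trans h2.2
      cases x; cases y
      simp only at e1 e2
      subst e1; subst e2; rfl
  rw [Finset.card_sigma] at hcard
  have : B.card * n ≤ ∑ b ∈ B, (A b).card := by
    rw [← smul_eq_mul]
    exact Finset.card_nsmul_le_sum B _ n hA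
  omega

lemma balanced {V : Type*} [DecidableEq V] {K : ℕ} (hK : 0 < K) (s : Finset V) :
    ∃ f : V → Fin K, ∀ α, K * (s.val.map f).count α ≤ s.card + (K - 1) := by
  classical
  induction s using Finset.induction_on with
  | empty => exact ⟨fun _ => ⟨0, hK⟩, by simp⟩
  | insert a s ha ih =>
    obtain ⟨f, hf⟩ := ih
    have : Nonempty (Fin K) := ⟨⟨0, hK⟩⟩
    obtain ⟨α, -, hα⟩ := Finset.exists_min_image (univ : Finset (Fin K))
      (fun α => (s.val.map f).count α) ⟨⟨0, hK⟩, mem_univ _⟩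
    have hmin : K * (s.val.map f).count α ≤ s.card := by
      have h1 : ∑ β : Fin K, (s.val.map f).count β = s.card := by
        rw [Multiset.sum_count_eq_card (fun a _ => Finset.mem_univ a)]
        simp
      rw [← h1]
      have := Finset.card_nsmul_le_sum (univ : Finset (Fin K))
        (fun β => (s.val.map f).count β) _ hα
      simpa using this
    refine ⟨Function.update f a α, ?_⟩
    intro β
    have hm : ((insert a s).val.map (Function.update f a α)) = α ::ₘ s.val.map f := by
      rw [Finset.insert_val_of_notMem ha, Multiset.map_cons]
      congr 1
      · simp
      · apply Multiset.map_congr rfl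
        intro x hx
        rw [Function.update_of_ne]
        rintro rfl
        exact ha hx
    rw [hm, Finset.card_insert_of_notMem ha, Multiset.count_cons]
    have := hf β
    split_ifs with h
    · subst h
      rw [mul_add]
      omega
    · rw [add_zero]
      omega

end pick
end MDC

namespace MDC
open Finset

section order
variable {V : Type*} [Fintype V] [DecidableEq V]

/-- a search order rooted at `r` -/
structure GoodOrd (G : SimpleGraph V) (r : V) (o : V → ℚ) : Prop where
  inj : Function.Injective o
  root : ∀ v, v ≠ r → o r < o v
  back : ∀ v, v ≠ r → ∃ y, G.Adj v y ∧ o y < o v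

/-- a vertex without later neighbors having a later false twin -/
def Viol (G : SimpleGraph V) (o : V → ℚ) (z : V) : Prop :=
  (∃ x, o z < o x ∧ ∀ y, G.Adj z y ↔ G.Adj x y) ∧ ∀ y, G.Adj z y → o y < o z

lemma exists_ord0 (G : SimpleGraph V) (r : V) (hconn : G.Connected) :
    ∃ o : V → ℚ, GoodOrd G r o := by
  classical
  let e := Fintype.equivFin V
  let n := Fintype.card V
  let o : V → ℕ := fun v => G.dist r v * n + (e v).val
  have hlt : ∀ u v, G.dist r u < G.dist r v → o u < o v := by
    intro u v h
    have h1 : (G.dist r u + 1) * n ≤ G.dist r v * n := Nat.mul_le_mul_right _ h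
    have h2 := (e u).isLt
    simp only [o]
    rw [add_mul] at h1
    have h3 : (e u).val < n := h2
    omega
  refine ⟨fun v => (o v : ℚ), ?_, ?_, ?_⟩
  · intro u v h
    have h2 : ((o u : ℕ) : ℚ) = (o v : ℕ) := h
    have h' : o u = o v := by exact_mod_cast h2
    have hd : G.dist r u = G.dist r v := by
      rcases lt_trichotomy (G.dist r u) (G.dist r v) with h1 | h1 | h1
      · have := hlt _ _ h1; omega
      · exact h1
      · have := hlt _ _ h1; omega
    simp only [o] at h'
    rw [hd] at h'
    have : (e u).val = (e v).val := by omega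
    exact e.injective (Fin.ext this)
  · intro v hv
    have : o r < o v := by
      apply hlt
      rw [SimpleGraph.dist_self]
      exact hconn.pos_dist_of_ne (Ne.symm hv)
    exact_mod_cast this
  · intro v hv
    obtain ⟨w, hw⟩ := hconn.exists_walk_length_eq_dist v r
    cases w with
    | nil => exact absurd rfl hv
    | @cons _ y _ hadj w' =>
      refine ⟨y, hadj, ?_⟩
      have : o y < o v := by
        apply hlt
        have h1 : G.dist y r ≤ w'.length := SimpleGraph.dist_le w'
        rw [SimpleGraph.Walk.length_cons] at hw
        rw [SimpleGraph.dist_comm, G.dist_comm (u := r) (v := v)]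
        omega
      exact_mod_cast this

lemma exists_ord_aux (G : SimpleGraph V) [DecidableRel G.Adj] (r : V)
    (hδ : ∀ v : V, 2 ≤ G.degree v) (n : ℕ) :
    ∀ o : V → ℚ, GoodOrd G r o → {z | Viol G o z}.ncard = n →
      ∃ o' : V → ℚ, GoodOrd G r o' ∧ ∀ z, ¬ Viol G o' z := by
  induction n using Nat.strong_induction_on with
  | _ n ih =>
  intro o ho hn
  by_cases hv : ∃ z, Viol G o z
  swap
  · exact ⟨o, ho, fun z hz => hv ⟨z, hz⟩⟩
  obtain ⟨z, hz⟩ := hv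
  obtain ⟨⟨x, hzx, htw⟩, hback⟩ := hz
  have hcard : 1 < (G.neighborFinset z).card := by
    rw [G.card_neighborFinset_eq_degree]; have := hδ z; omega
  obtain ⟨y0, hy0, hmin⟩ := Finset.exists_min_image (G.neighborFinset z) o
    (Finset.card_pos.1 (by omega))
  obtain ⟨y1, hy1, hy10⟩ := Finset.exists_mem_ne hcard y0
  rw [G.mem_neighborFinset] at hy0 hy1
  have hy0z := hback y0 hy0
  -- the new position
  obtain ⟨m, hm, hmmin⟩ := Finset.exists_min_image (univ.filter (fun w => o y0 < o w)) o
    ⟨z, by simp [hy0z]⟩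
  simp only [mem_filter, mem_univ, true_and] at hm hmmin
  set q : ℚ := (o y0 + o m) / 2 with hq
  have hq1 : o y0 < q := by rw [hq]; linarith
  have hq2 : ∀ w, o y0 < o w → q < o w := by
    intro w hw
    have := hmmin w hw
    rw [hq]; linarith
  have hq3 : ∀ w, o w ≤ o y0 → o w < q := fun w hw => lt_of_le_of_lt hw hq1
  have hqz : q < o z := hq2 z hy0z
  have hqne : ∀ w, o w ≠ q := by
    intro w hw
    rcases le_or_gt (o w) (o y0) with h | h
    · exact absurd hw (hq3 w h).ne
    · exact absurd hw (hq2 w h).ne'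
  set o' : V → ℚ := Function.update o z q with ho'
  have oz : o' z = q := by simp [ho']
  have one : ∀ w, w ≠ z → o' w = o w := fun w hw => by simp [ho', hw]
  have hy0nz : y0 ≠ z := by rintro rfl; exact lt_irrefl _ hy0z
  have hzr : z ≠ r := by
    rintro rfl
    have := ho.root y0 hy0nz
    linarith
  have hle : ∀ w, o' w ≤ o w := by
    intro w
    by_cases h : w = z
    · subst h; rw [oz]; exact hqz.le
    · rw [one w h]
  have hgood : GoodOrd G r o' := by
    refine ⟨?_, ?_, ?_⟩
    · intro a b hab
      by_cases ha : a = z <;> by_cases hb : b = z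
      · rw [ha, hb]
      · subst ha; rw [oz, one b hb] at hab; exact absurd hab.symm (hqne b)
      · subst hb; rw [oz, one a ha] at hab; exact absurd hab (hqne a)
      · rw [one a ha, one b hb] at hab; exact ho.inj hab
    · intro v hv
      rw [one r (Ne.symm hzr)]
      by_cases h : v = z
      · subst h; rw [oz]
        by_cases h0 : y0 = r
        · rw [← h0]; exact hq1
        · exact (ho.root y0 h0).trans hq1
      · rw [one v h]; exact ho.root v hv
    · intro v hv
      by_cases h : v = z
      · subst h
        exact ⟨y0, hy0, by rw [oz, one y0 hy0nz]; exact hq1⟩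
      · obtain ⟨y, hy, hyv⟩ := ho.back v hv
        exact ⟨y, hy, by rw [one v h]; exact lt_of_le_of_lt (hle y) hyv⟩
  have hsub : {w | Viol G o' w} ⊂ {w | Viol G o w} := by
    rw [Set.ssubset_iff_of_subset]
    · refine ⟨z, ⟨⟨x, hzx, htw⟩, hback⟩, ?_⟩
      rintro ⟨-, h⟩
      have h1 := h y1 hy1
      have h2 : y1 ≠ z := fun h => by subst h; exact G.irrefl hy1
      rw [oz, one y1 h2] at h1
      have h3 : o y0 < o y1 := lt_of_le_of_ne
        (hmin y1 (by rw [G.mem_neighborFinset]; exact hy1)) (fun h => hy10 (ho.inj h).symm)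
      have := hq2 y1 h3
      linarith
    · rintro w ⟨⟨x', hx', htw'⟩, hw⟩
      have hwz : w ≠ z := by
        rintro rfl
        have h1 := hw y1 hy1
        have h2 : y1 ≠ w := fun h => by subst h; exact G.irrefl hy1
        rw [oz, one y1 h2] at h1
        have h3 : o y0 < o y1 := lt_of_le_of_ne
          (hmin y1 (by rw [G.mem_neighborFinset]; exact hy1)) (fun h => hy10 (ho.inj h).symm)
        have := hq2 y1 h3
        linarith
      refine ⟨⟨x', ?_, htw'⟩, ?_⟩
      · rw [one w hwz] at hx'
        exact lt_of_lt_of_le hx' (hle x')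
      · intro y hy
        by_cases hyz : y = z
        · subst hyz
          have hxw : G.Adj w x := ((htw w).1 hy.symm).symm
          have h1 := hw x hxw
          have hxz : x ≠ y := by rintro rfl; exact lt_irrefl _ hzx
          rw [one x hxz, one w hwz] at h1
          exact hzx.trans h1
        · have h1 := hw y hy
          rwa [one y hyz, one w hwz] at h1
  have hlt := Set.ncard_lt_ncard hsub (Set.toFinite _)
  exact ih _ (hn ▸ hlt) o' hgood rfl

lemma exists_ord (G : SimpleGraph V) [DecidableRel G.Adj] (r : V) (hconn : G.Connected)
    (hδ : ∀ v : V, 2 ≤ G.degree v) :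
    ∃ o : V → ℚ, GoodOrd G r o ∧ ∀ z, ¬ Viol G o z := by
  obtain ⟨o, ho⟩ := exists_ord0 G r hconn
  exact exists_ord_aux G r hδ _ o ho rfl

end order
end MDC

namespace MDC
open Finset

section arcs
variable {V : Type*} [Fintype V] [DecidableEq V] {K : ℕ}
variable (G : SimpleGraph V) [DecidableRel G.Adj]

/-- colors of the arcs of `D` leaving `u` -/
def outM (D : Finset (V × V)) (c : V → V → Fin K) (u : V) : Multiset (Fin K) :=
  ((G.neighborFinset u).filter (fun v => (u, v) ∈ D)).val.map (fun v => c u v)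

/-- colors of the arcs of `D` entering `u` -/
def inM (D : Finset (V × V)) (c : V → V → Fin K) (u : V) : Multiset (Fin K) :=
  ((G.neighborFinset u).filter (fun v => (v, u) ∈ D)).val.map (fun v => c v u)

/-- recolor one arc -/
def upd (c : V → V → Fin K) (u v : V) (α : Fin K) : V → V → Fin K :=
  fun a b => if a = u ∧ b = v then α else c a b

/-- the palette of the root -/
def Pal (r : V) (c0 : V → Fin K) : Multiset (Fin K) := (G.neighborFinset r).val.map c0

variable {G}

lemma outM_congr {D D' : Finset (V × V)} {c c' : V → V → Fin K} {u : V}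
    (hD : ∀ v, G.Adj u v → ((u, v) ∈ D ↔ (u, v) ∈ D'))
    (h : ∀ v, G.Adj u v → (u, v) ∈ D → c u v = c' u v) : outM G D c u = outM G D' c' u := by
  unfold outM
  have : (G.neighborFinset u).filter (fun v => (u, v) ∈ D)
      = (G.neighborFinset u).filter (fun v => (u, v) ∈ D') := by
    apply Finset.filter_congr
    intro v hv
    rw [G.mem_neighborFinset] at hv
    exact hD v hv
  rw [← this]
  apply Multiset.map_congr rfl
  intro v hv
  rw [Finset.mem_val, Finset.mem_filter, G.mem_neighborFinset] at hv
  exact h v hv.1 hv.2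

lemma inM_congr {D D' : Finset (V × V)} {c c' : V → V → Fin K} {u : V}
    (hD : ∀ v, G.Adj u v → ((v, u) ∈ D ↔ (v, u) ∈ D'))
    (h : ∀ v, G.Adj u v → (v, u) ∈ D → c v u = c' v u) : inM G D c u = inM G D' c' u := by
  unfold inM
  have : (G.neighborFinset u).filter (fun v => (v, u) ∈ D)
      = (G.neighborFinset u).filter (fun v => (v, u) ∈ D') := by
    apply Finset.filter_congr
    intro v hv
    rw [G.mem_neighborFinset] at hv
    exact hD v hv
  rw [← this]
  apply Multiset.map_congr rfl
  intro v hv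
  rw [Finset.mem_val, Finset.mem_filter, G.mem_neighborFinset] at hv
  exact h v hv.1 hv.2

lemma outM_cons {D : Finset (V × V)} {c : V → V → Fin K} {u v : V} (h : G.Adj u v)
    (hD : (u, v) ∈ D) : outM G D c u = c u v ::ₘ outM G (D.erase (u, v)) c u := by
  unfold outM
  have : (G.neighborFinset u).filter (fun w => (u, w) ∈ D)
      = insert v ((G.neighborFinset u).filter (fun w => (u, w) ∈ D.erase (u, v))) := by
    ext w
    simp only [mem_insert, mem_filter, mem_neighborFinset, mem_erase, ne_eq, Prod.mk.injEq,
      true_and]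
    by_cases hw : w = v
    · subst hw; simp [h, hD]
    · simp [hw]
  rw [this, Finset.insert_val_of_notMem (by simp), Multiset.map_cons]

lemma inM_cons {D : Finset (V × V)} {c : V → V → Fin K} {u v : V} (h : G.Adj u v)
    (hD : (v, u) ∈ D) : inM G D c u = c v u ::ₘ inM G (D.erase (v, u)) c u := by
  unfold inM
  have : (G.neighborFinset u).filter (fun w => (w, u) ∈ D)
      = insert v ((G.neighborFinset u).filter (fun w => (w, u) ∈ D.erase (v, u))) := by
    ext w
    simp only [mem_insert, mem_filter, mem_neighborFinset, mem_erase, ne_eq, Prod.mk.injEq,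
      and_true]
    by_cases hw : w = v
    · subst hw; simp [h, hD]
    · simp [hw]
  rw [this, Finset.insert_val_of_notMem (by simp), Multiset.map_cons]

lemma outM_ins {D : Finset (V × V)} {c : V → V → Fin K} {u v : V} (α : Fin K)
    (h : G.Adj u v) (hD : (u, v) ∉ D) :
    outM G (insert (u, v) D) (upd c u v α) u = α ::ₘ outM G D c u := by
  rw [outM_cons h (mem_insert_self _ _), Finset.erase_insert hD]
  congr 1
  · simp [upd]
  · apply outM_congr (fun _ _ => Iff.rfl)
    intro w _ hw
    have : w ≠ v := by rintro rfl; exact hD hw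
    simp [upd, this]

lemma inM_ins {D : Finset (V × V)} {c : V → V → Fin K} {u v : V} (α : Fin K)
    (h : G.Adj u v) (hD : (u, v) ∉ D) :
    inM G (insert (u, v) D) (upd c u v α) v = α ::ₘ inM G D c v := by
  rw [inM_cons h.symm (mem_insert_self _ _), Finset.erase_insert hD]
  congr 1
  · simp [upd]
  · apply inM_congr (fun _ _ => Iff.rfl)
    intro w _ hw
    have : w ≠ u := by rintro rfl; exact hD hw
    simp [upd, this]

lemma outM_ins_ne {D : Finset (V × V)} {c : V → V → Fin K} {u v w : V} (α : Fin K)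
    (h : w ≠ u) : outM G (insert (u, v) D) (upd c u v α) w = outM G D c w := by
  apply outM_congr
  · intro y _; simp [h]
  · intro y _ _; simp [upd, h]

lemma inM_ins_ne {D : Finset (V × V)} {c : V → V → Fin K} {u v w : V} (α : Fin K)
    (h : w ≠ v) : inM G (insert (u, v) D) (upd c u v α) w = inM G D c w := by
  apply inM_congr
  · intro y _; simp [h]
  · intro y _ _; simp [upd, h]

lemma card_outM {D : Finset (V × V)} {c : V → V → Fin K} {u : V} :
    (outM G D c u).card = ((G.neighborFinset u).filter (fun v => (u, v) ∈ D)).card := by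
  rw [outM, Multiset.card_map, Finset.card_def]

lemma card_inM {D : Finset (V × V)} {c : V → V → Fin K} {u : V} :
    (inM G D c u).card = ((G.neighborFinset u).filter (fun v => (v, u) ∈ D)).card := by
  rw [inM, Multiset.card_map, Finset.card_def]

lemma miss_one {u v : V} {q : V → Prop} [DecidablePred q] (h : G.Adj u v) (hq : ¬ q v) :
    ((G.neighborFinset u).filter q).card + 1 ≤ G.degree u := by
  rw [← G.card_neighborFinset_eq_degree]
  have : ((G.neighborFinset u).filter q) ⊂ G.neighborFinset u := by
    rw [Finset.filter_ssubset]
    exact ⟨v, by simpa using h, hq⟩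
  exact Finset.card_lt_card this

lemma miss_two {u v w : V} {q : V → Prop} [DecidablePred q] (h : G.Adj u v) (hq : ¬ q v)
    (h' : G.Adj u w) (hq' : ¬ q w) (hvw : v ≠ w) :
    ((G.neighborFinset u).filter q).card + 2 ≤ G.degree u := by
  rw [← G.card_neighborFinset_eq_degree]
  have h1 : ((G.neighborFinset u).filter q) ⊆ ((G.neighborFinset u).erase v).erase w := by
    intro y hy
    rw [mem_filter] at hy
    rw [mem_erase, mem_erase]
    refine ⟨?_, ?_, hy.1⟩
    · rintro rfl; exact hq' hy.2
    · rintro rfl; exact hq hy.2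
  have h2 := Finset.card_le_card h1
  have h3 : w ∈ (G.neighborFinset u).erase v := by
    rw [mem_erase]; exact ⟨hvw.symm, by simpa using h'⟩
  have h4 : v ∈ G.neighborFinset u := by simpa using h
  have := Finset.card_erase_add_one h3
  have := Finset.card_erase_add_one h4
  omega

/-- a partial majority coloring in which the root has a unique palette -/
structure Valid (G : SimpleGraph V) [DecidableRel G.Adj] (r : V) (c0 : V → Fin K)
    (D : Finset (V × V)) (c : V → V → Fin K) : Prop where
  out : ∀ u α, 2 * (outM G D c u).count α ≤ G.degree u
  inn : ∀ u α, 2 * (inM G D c u).count α ≤ G.degree u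
  pal : ∀ u, u ≠ r → G.degree u = G.degree r → outM G D c u ≠ Pal G r c0
  root : ∀ v, c r v = c0 v

lemma card_Pal {r : V} {c0 : V → Fin K} : (Pal G r c0).card = G.degree r := by
  simp [Pal]

lemma outM_mono {D D' : Finset (V × V)} (h : D' ⊆ D) (c : V → V → Fin K) (u : V) :
    outM G D' c u ≤ outM G D c u := by
  apply Multiset.map_le_map
  rw [Finset.val_le_iff]
  intro v hv
  rw [mem_filter] at hv ⊢
  exact ⟨hv.1, h hv.2⟩

lemma inM_mono {D D' : Finset (V × V)} (h : D' ⊆ D) (c : V → V → Fin K) (u : V) :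
    inM G D' c u ≤ inM G D c u := by
  apply Multiset.map_le_map
  rw [Finset.val_le_iff]
  intro v hv
  rw [mem_filter] at hv ⊢
  exact ⟨hv.1, h hv.2⟩

lemma Valid.mono {r : V} {c0 : V → Fin K} {D D' : Finset (V × V)} {c : V → V → Fin K}
    (hv : Valid G r c0 D c) (h : D' ⊆ D) : Valid G r c0 D' c := by
  refine ⟨?_, ?_, ?_, hv.root⟩
  · intro u α
    have := Multiset.count_le_of_le α (outM_mono (G := G) h c u)
    have := hv.out u α
    omega
  · intro u α
    have := Multiset.count_le_of_le α (inM_mono (G := G) h c u)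
    have := hv.inn u α
    omega
  · intro u hu hd he
    apply hv.pal u hu hd
    rw [← he]
    symm
    apply Multiset.eq_of_le_of_card_le (outM_mono h c u)
    rw [he, card_Pal, ← hd, card_outM, ← G.card_neighborFinset_eq_degree]
    exact Finset.card_filter_le _ _

/-- colors available for the arc `(u,v)` -/
def opts (G : SimpleGraph V) [DecidableRel G.Adj] (r : V) (c0 : V → Fin K)
    (D : Finset (V × V)) (c : V → V → Fin K) (u v : V) : Finset (Fin K) :=
  univ \ (forbF (G.degree u) (u ≠ r ∧ G.degree u = G.degree r) (Pal G r c0) (outM G D c u) ∪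
    satF (G.degree v) (inM G D c v))

lemma opts_ins {r : V} {c0 : V → Fin K} {D : Finset (V × V)} {c : V → V → Fin K}
    {a b u v : V} (α : Fin K) (h1 : u ≠ a) (h2 : v ≠ b) :
    opts G r c0 (insert (a, b) D) (upd c a b α) u v = opts G r c0 D c u v := by
  unfold opts
  rw [outM_ins_ne α h1, inM_ins_ne α h2]

lemma opts_card {r : V} {c0 : V → Fin K} {D : Finset (V × V)} {c : V → V → Fin K}
    {u v : V} {m n : ℕ}
    (h1 : (forbF (G.degree u) (u ≠ r ∧ G.degree u = G.degree r) (Pal G r c0)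
      (outM G D c u)).card ≤ m)
    (h2 : (satF (G.degree v) (inM G D c v)).card ≤ n) :
    K ≤ (opts G r c0 D c u v).card + (m + n) := by
  unfold opts
  have h3 := Finset.le_card_sdiff (forbF (G.degree u) (u ≠ r ∧ G.degree u = G.degree r)
    (Pal G r c0) (outM G D c u) ∪ satF (G.degree v) (inM G D c v)) univ
  have h4 := Finset.card_union_le (forbF (G.degree u) (u ≠ r ∧ G.degree u = G.degree r)
    (Pal G r c0) (outM G D c u)) (satF (G.degree v) (inM G D c v))
  rw [Finset.card_univ, Fintype.card_fin] at h3
  omega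

lemma Valid.extend {r : V} {c0 : V → Fin K} {D : Finset (V × V)} {c : V → V → Fin K}
    (hv : Valid G r c0 D c) {u v : V} {α : Fin K} (hD : (u, v) ∉ D) (hA : G.Adj u v)
    (hu : u ≠ r) (hα : α ∈ opts G r c0 D c u v) :
    Valid G r c0 (insert (u, v) D) (upd c u v α) := by
  unfold opts at hα
  rw [mem_sdiff, mem_union, not_or, mem_forbF, mem_satF] at hα
  obtain ⟨-, h1, h2⟩ := hα
  push Not at h1
  refine ⟨?_, ?_, ?_, ?_⟩
  · intro w β
    by_cases hw : w = u
    · subst hw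
      rw [outM_ins α hA hD]
      by_cases hb : β = α
      · subst hb; exact h1.1
      · rw [Multiset.count_cons_of_ne hb]; exact hv.out w β
    · rw [outM_ins_ne α hw]; exact hv.out w β
  · intro w β
    by_cases hw : w = v
    · subst hw
      rw [inM_ins α hA hD]
      by_cases hb : β = α
      · subst hb; rw [Multiset.count_cons_self]; omega
      · rw [Multiset.count_cons_of_ne hb]; exact hv.inn w β
    · rw [inM_ins_ne α hw]; exact hv.inn w β
  · intro w hw hd
    by_cases hwu : w = u
    · subst hwu
      rw [outM_ins α hA hD]
      exact h1.2 ⟨hw, hd⟩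
    · rw [outM_ins_ne α hwu]; exact hv.pal w hw hd
  · intro w
    have : r ≠ u := hu.symm
    simp [upd, this, hv.root]

lemma exists_valid {r : V} {c0 : V → Fin K} (hK : 6 ≤ K) (hδ : ∀ v, 2 ≤ G.degree v)
    (hc0 : ∀ α, 2 * (Pal G r c0).count α ≤ G.degree r) :
    ∃ c, Valid G r c0 univ c := by
  let D0 : Finset (V × V) := univ.filter (fun a => a.1 = r)
  suffices h : ∀ E : Finset (V × V), ∃ c, Valid G r c0 (D0 ∪ E) c by
    obtain ⟨c, hc⟩ := h univ
    exact ⟨c, hc.mono (fun a _ => mem_union_right _ (mem_univ a))⟩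
  intro E
  induction E using Finset.induction_on with
  | empty =>
    refine ⟨fun _ b => c0 b, ?_⟩
    rw [Finset.union_empty]
    have hr : outM G D0 (fun _ b => c0 b) r = Pal G r c0 := by
      unfold outM Pal
      congr 2
      apply Finset.filter_true_of_mem
      intro v _
      simp [D0]
    have hnr : ∀ u, u ≠ r → outM G D0 (fun _ b => c0 b) u = 0 := by
      intro u hu
      unfold outM
      rw [Finset.filter_false_of_mem]
      · rfl
      · intro v _
        simp [D0, hu]
    refine ⟨?_, ?_, ?_, fun _ => rfl⟩
    · intro u α
      by_cases hu : u = r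
      · subst hu; rw [hr]; exact hc0 α
      · rw [hnr u hu]; simp
    · intro u α
      have h1 : (inM G D0 (fun _ b => c0 b) u).card ≤ 1 := by
        rw [card_inM, Finset.card_le_one]
        intro a ha b hb
        simp only [D0, mem_filter, mem_univ, true_and] at ha hb
        rw [ha.2, hb.2]
      have h2 := Multiset.count_le_card α (inM G D0 (fun _ b => c0 b) u)
      have := hδ u
      omega
    · intro u hu hd
      rw [hnr u hu]
      intro h
      have h2 := congrArg Multiset.card h
      rw [card_Pal] at h2
      have := hδ r
      simp at h2
      omega
  | insert a E ha ih =>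
    obtain ⟨c, hc⟩ := ih
    obtain ⟨u, v⟩ := a
    rw [Finset.union_insert]
    by_cases hm : (u, v) ∈ D0 ∪ E
    · rw [Finset.insert_eq_of_mem hm]; exact ⟨c, hc⟩
    by_cases hA : G.Adj u v
    · have hu : u ≠ r := by
        rintro rfl
        apply hm
        simp [D0]
      have h1 := opts_card (r := r) (c0 := c0) (D := D0 ∪ E) (c := c) (u := u) (v := v)
        (forbF_card_le_three (hδ u) (by rw [card_outM]; exact miss_one hA hm))
        (satF_card_le_two (hδ v) (by rw [card_inM]; exact miss_one hA.symm hm))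
      obtain ⟨α, hα⟩ := Finset.card_pos.1 (show 0 < (opts G r c0 (D0 ∪ E) c u v).card by omega)
      exact ⟨_, hc.extend hm hA hu hα⟩
    · refine ⟨c, ?_⟩
      have ho : ∀ w, outM G (insert (u, v) (D0 ∪ E)) c w = outM G (D0 ∪ E) c w := by
        intro w
        apply outM_congr
        · intro y hy
          have : (w, y) ≠ (u, v) := by
            rintro h
            cases h
            exact hA hy
          rw [mem_insert]; tauto
        · intros; rfl
      have hi : ∀ w, inM G (insert (u, v) (D0 ∪ E)) c w = inM G (D0 ∪ E) c w := by
        intro w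
        apply inM_congr
        · intro y hy
          have : (y, w) ≠ (u, v) := by
            rintro h
            cases h
            exact hA hy.symm
          rw [mem_insert]; tauto
        · intros; rfl
      refine ⟨?_, ?_, ?_, hc.root⟩
      · intro w; rw [ho]; exact hc.out w
      · intro w; rw [hi]; exact hc.inn w
      · intro w; rw [ho]; exact hc.pal w

/-- color preserving automorphisms -/
def Pres (G : SimpleGraph V) (c : V → V → Fin K) (φ : G ≃g G) : Prop :=
  ∀ u v, G.Adj u v → c (φ u) (φ v) = c u v

lemma outM_map {D D' : Finset (V × V)} {c : V → V → Fin K} {φ : G ≃g G} (hφ : Pres G c φ)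
    (u : V) (hD : ∀ v, G.Adj u v → ((φ u, φ v) ∈ D' ↔ (u, v) ∈ D)) :
    outM G D' c (φ u) = outM G D c u := by
  unfold outM
  have h : (G.neighborFinset (φ u)).filter (fun v => (φ u, v) ∈ D')
      = ((G.neighborFinset u).filter (fun v => (u, v) ∈ D)).map φ.toEquiv.toEmbedding := by
    ext w
    obtain ⟨v, rfl⟩ := φ.surjective w
    simp only [mem_filter, mem_neighborFinset, Finset.mem_map, Equiv.coe_toEmbedding]
    constructor
    · rintro ⟨h1, h2⟩
      have h3 : G.Adj u v := φ.map_adj_iff.1 h1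
      exact ⟨v, ⟨h3, (hD v h3).1 h2⟩, rfl⟩
    · rintro ⟨v', ⟨h1, h2⟩, h3⟩
      have h4 : v' = v := φ.injective h3
      subst h4
      exact ⟨φ.map_adj_iff.2 h1, (hD v' h1).2 h2⟩
  rw [h, Finset.map_val, Multiset.map_map]
  apply Multiset.map_congr rfl
  intro v hv
  rw [Finset.mem_val, Finset.mem_filter, G.mem_neighborFinset] at hv
  exact hφ u v hv.1

lemma inM_map {D D' : Finset (V × V)} {c : V → V → Fin K} {φ : G ≃g G} (hφ : Pres G c φ)
    (u : V) (hD : ∀ v, G.Adj u v → ((φ v, φ u) ∈ D' ↔ (v, u) ∈ D)) :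
    inM G D' c (φ u) = inM G D c u := by
  unfold inM
  have h : (G.neighborFinset (φ u)).filter (fun v => (v, φ u) ∈ D')
      = ((G.neighborFinset u).filter (fun v => (v, u) ∈ D)).map φ.toEquiv.toEmbedding := by
    ext w
    obtain ⟨v, rfl⟩ := φ.surjective w
    simp only [mem_filter, mem_neighborFinset, Finset.mem_map, Equiv.coe_toEmbedding]
    constructor
    · rintro ⟨h1, h2⟩
      have h3 : G.Adj u v := φ.map_adj_iff.1 h1
      exact ⟨v, ⟨h3, (hD v h3).1 h2⟩, rfl⟩
    · rintro ⟨v', ⟨h1, h2⟩, h3⟩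
      have h4 : v' = v := φ.injective h3
      subst h4
      exact ⟨φ.map_adj_iff.2 h1, (hD v' h1).2 h2⟩
  rw [h, Finset.map_val, Multiset.map_map]
  apply Multiset.map_congr rfl
  intro v hv
  rw [Finset.mem_val, Finset.mem_filter, G.mem_neighborFinset] at hv
  exact hφ v u hv.1.symm

lemma Valid.fix_root {r : V} {c0 : V → Fin K} {c : V → V → Fin K}
    (hv : Valid G r c0 univ c) {φ : G ≃g G} (hφ : Pres G c φ) : φ r = r := by
  by_contra hne
  apply hv.pal (φ r) hne (φ.degree_eq r)
  rw [outM_map hφ r (D := univ) (by simp)]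
  unfold outM Pal
  rw [Finset.filter_true_of_mem (by simp)]
  apply Multiset.map_congr rfl
  intro v _
  exact hv.root v

lemma count_outM {c : V → V → Fin K} {u : V} {α : Fin K} :
    (outM G univ c u).count α = ((G.neighborFinset u).filter (fun v => c u v = α)).card := by
  unfold outM
  rw [Finset.filter_true_of_mem (by simp), Multiset.count_map, Finset.card_def, Finset.filter_val]
  congr 1
  apply Multiset.filter_congr
  intro x _
  exact eq_comm

lemma count_inM {c : V → V → Fin K} {u : V} {α : Fin K} :
    (inM G univ c u).count α = ((G.neighborFinset u).filter (fun v => c v u = α)).card := by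
  unfold inM
  rw [Finset.filter_true_of_mem (by simp), Multiset.count_map, Finset.card_def, Finset.filter_val]
  congr 1
  apply Multiset.filter_congr
  intro x _
  exact eq_comm

lemma Valid.small {r : V} {c0 : V → Fin K} {c : V → V → Fin K} (hconn : G.Connected)
    (hv : Valid G r c0 univ c) (hΔ : ∀ v, G.degree v ≤ 3) {φ : G ≃g G} (hφ : Pres G c φ) :
    ∀ x, φ x = x := by
  have step : ∀ u v, G.Adj u v → φ u = u → φ v = v := by
    intro u v huv hu
    have h1 := hv.out u (c u v)
    have h2 := hΔ u
    rw [count_outM] at h1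
    have h3 : ((G.neighborFinset u).filter (fun w => c u w = c u v)).card ≤ 1 := by omega
    rw [Finset.card_le_one] at h3
    apply h3
    · rw [mem_filter, G.mem_neighborFinset]
      have h4 := hφ u v huv
      have h5 := φ.map_adj_iff.2 huv
      rw [hu] at h4 h5
      exact ⟨h5, h4⟩
    · rw [mem_filter, G.mem_neighborFinset]
      exact ⟨huv, rfl⟩
  intro x
  obtain ⟨w⟩ := hconn.preconnected r x
  have hr := hv.fix_root hφ
  clear hv
  induction w with
  | nil => exact hr
  | cons hadj _ ih => exact ih (step _ _ hadj hr)

end arcs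
end MDC

namespace MDC
open Finset

section recol
variable {V : Type*} [Fintype V] [DecidableEq V] {K : ℕ}
variable {G : SimpleGraph V} [DecidableRel G.Adj]

/-- recolor the four arcs joining `u` to `x` and to `p` -/
def recol (c : V → V → Fin K) (u x p : V) (b1 b2 a1 a2 : Fin K) : V → V → Fin K :=
  upd (upd (upd (upd c x u b2) u x b1) u p a1) p u a2

lemma Valid.congr {r : V} {c0 : V → Fin K} {D D' : Finset (V × V)} {c c' : V → V → Fin K}
    (hv : Valid G r c0 D c) (h : D = D') (h' : c = c') : Valid G r c0 D' c' := by
  subst h; subst h'; exact hv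

lemma core {t : ℕ} {r : V} {c0 : V → Fin K} {c : V → V → Fin K} (hK : K = t + 4)
    (hδ : ∀ v, 2 ≤ G.degree v) (hP : ∀ α, 2 * (Pal G r c0).count α + 2 ≤ G.degree r)
    (hv : Valid G r c0 univ c) {u x p : V} (hux : G.Adj u x) (hup : G.Adj u p) (hxp : x ≠ p)
    (hur : u ≠ r) (hxr : x ≠ r) :
    ∃ (O1 O2 : Finset (Fin K)) (O3 O4 : Fin K → Fin K → Finset (Fin K)),
      t + 1 ≤ O1.card ∧ (∀ b1 ∈ O1, ∀ b2 ∈ O2, t ≤ (O3 b1 b2).card) ∧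
      (p ≠ r → t + 1 ≤ O2.card ∧ ∀ b1 ∈ O1, ∀ b2 ∈ O2, t ≤ (O4 b1 b2).card) ∧
      (p = r → t ≤ O2.card ∧ ∀ b1 b2, O4 b1 b2 = {c r u}) ∧
      ∀ b1 ∈ O1, ∀ b2 ∈ O2, ∀ a1 ∈ O3 b1 b2, ∀ a2 ∈ O4 b1 b2,
        Valid G r c0 univ (recol c u x p b1 b2 a1 a2) := by
  have hne : u ≠ x := hux.ne
  have hnp : u ≠ p := hup.ne
  have F2 : ∀ (D : Finset (V × V)) (c : V → V → Fin K) (a b : V), G.Adj a b → (a, b) ∉ D →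
      (forbF (G.degree a) (a ≠ r ∧ G.degree a = G.degree r) (Pal G r c0)
      (outM G D c a)).card ≤ 2 := by
    intro D c a b hab hD
    apply forbF_card_le_two (hδ a) (by rw [card_outM]; exact miss_one hab hD)
    rintro ⟨-, h⟩ α
    rw [h]; exact hP α
  have F1 : ∀ (D : Finset (V × V)) (c : V → V → Fin K) (a b b' : V), G.Adj a b → (a, b) ∉ D →
      G.Adj a b' → (a, b') ∉ D → b ≠ b' →
      (forbF (G.degree a) (a ≠ r ∧ G.degree a = G.degree r) (Pal G r c0)
      (outM G D c a)).card ≤ 1 := by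
    intro D c a b b' hab hD hab' hD' hb
    apply forbF_card_le_one (by rw [card_outM]; exact miss_two hab hD hab' hD' hb)
    rintro ⟨-, h⟩
    rw [h]; exact card_Pal
  have S2 : ∀ (D : Finset (V × V)) (c : V → V → Fin K) (a b : V), G.Adj a b → (b, a) ∉ D →
      (satF (G.degree a) (inM G D c a)).card ≤ 2 := by
    intro D c a b hab hD
    exact satF_card_le_two (hδ a) (by rw [card_inM]; exact miss_one hab hD)
  have S1 : ∀ (D : Finset (V × V)) (c : V → V → Fin K) (a b b' : V), G.Adj a b → (b, a) ∉ D →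
      G.Adj a b' → (b', a) ∉ D → b ≠ b' →
      (satF (G.degree a) (inM G D c a)).card ≤ 1 := by
    intro D c a b b' hab hD hab' hD' hb
    exact satF_card_le_one (by rw [card_inM]; exact miss_two hab hD hab' hD' hb)
  by_cases hpr : p = r
  · -- the arc from the root keeps its color
    let D0 : Finset (V × V) := ((univ.erase (u, x)).erase (x, u)).erase (u, p)
    have m1 : (u, x) ∉ D0 := by simp [D0]
    have m2 : (x, u) ∉ D0 := by simp [D0]
    have m3 : (u, p) ∉ D0 := by simp [D0]
    have v0 : Valid G r c0 D0 c := hv.mono (subset_univ _)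
    have m1' : (u, x) ∉ insert (x, u) D0 := by
      simp only [mem_insert, Prod.mk.injEq, not_or]; exact ⟨by tauto, m1⟩
    have m3' : (u, p) ∉ insert (u, x) (insert (x, u) D0) := by
      simp only [mem_insert, Prod.mk.injEq, not_or]; exact ⟨by tauto, by tauto, m3⟩
    refine ⟨opts G r c0 D0 c u x, opts G r c0 D0 c x u,
      fun b1 b2 => opts G r c0 (insert (u, x) (insert (x, u) D0))
        (upd (upd c x u b2) u x b1) u p, fun _ _ => {c r u}, ?_, ?_, ?_, ?_, ?_⟩
    · have := opts_card (F1 D0 c u x p hux m1 hup m3 hxp) (S2 D0 c x u hux.symm m1)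
      omega
    · intro b1 _ b2 _
      have := opts_card (F2 (insert (u, x) (insert (x, u) D0)) (upd (upd c x u b2) u x b1)
        u p hup m3') (S2 (insert (u, x) (insert (x, u) D0)) (upd (upd c x u b2) u x b1)
        p u hup.symm m3')
      beta_reduce
      omega
    · intro h; exact absurd hpr h
    · intro _
      refine ⟨?_, fun _ _ => rfl⟩
      have := opts_card (F2 D0 c x u hux.symm m2) (S2 D0 c u x hux m2)
      omega
    · intro b1 h1 b2 h2 a1 h3 a2 h4
      have v1 := v0.extend m2 hux.symm hxr h2
      have v2 := v1.extend m1' hux hur (by rw [opts_ins b2 hne hne.symm]; exact h1)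
      have v3 := v2.extend m3' hup hur h3
      apply v3.congr
      · ext ⟨a, b⟩
        simp only [D0, mem_insert, mem_erase, mem_univ, and_true, ne_eq, iff_true]
        tauto
      · rw [mem_singleton] at h4
        subst hpr
        funext a b
        by_cases h : a = p ∧ b = u
        · rw [h.1, h.2, h4]
          have e1 : p ≠ u := hnp.symm
          have e2 : p ≠ x := hxp.symm
          simp [recol, upd, e1, e2]
        · exact (if_neg h).symm
  · let D0 : Finset (V × V) := (((univ.erase (u, x)).erase (x, u)).erase (u, p)).erase (p, u)
    have m1 : (u, x) ∉ D0 := by simp [D0]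
    have m2 : (x, u) ∉ D0 := by simp [D0]
    have m3 : (u, p) ∉ D0 := by simp [D0]
    have m4 : (p, u) ∉ D0 := by simp [D0]
    have v0 : Valid G r c0 D0 c := hv.mono (subset_univ _)
    have m1' : (u, x) ∉ insert (x, u) D0 := by
      simp only [mem_insert, Prod.mk.injEq, not_or]; exact ⟨by tauto, m1⟩
    have m3' : (u, p) ∉ insert (u, x) (insert (x, u) D0) := by
      simp only [mem_insert, Prod.mk.injEq, not_or]; exact ⟨by tauto, by tauto, m3⟩
    have m4' : (p, u) ∉ insert (u, x) (insert (x, u) D0) := by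
      simp only [mem_insert, Prod.mk.injEq, not_or]; exact ⟨by tauto, by tauto, m4⟩
    have m4'' : (p, u) ∉ insert (u, p) (insert (u, x) (insert (x, u) D0)) := by
      rw [mem_insert, not_or]
      refine ⟨?_, m4'⟩
      simp only [Prod.mk.injEq]; tauto
    refine ⟨opts G r c0 D0 c u x, opts G r c0 D0 c x u,
      fun b1 b2 => opts G r c0 (insert (u, x) (insert (x, u) D0))
        (upd (upd c x u b2) u x b1) u p, fun b1 b2 => opts G r c0
        (insert (u, x) (insert (x, u) D0))
        (upd (upd c x u b2) u x b1) p u, ?_, ?_, ?_, ?_, ?_⟩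
    · have := opts_card (F1 D0 c u x p hux m1 hup m3 hxp) (S2 D0 c x u hux.symm m1)
      omega
    · intro b1 _ b2 _
      have := opts_card (F2 (insert (u, x) (insert (x, u) D0)) (upd (upd c x u b2) u x b1)
        u p hup m3') (S2 (insert (u, x) (insert (x, u) D0)) (upd (upd c x u b2) u x b1)
        p u hup.symm m3')
      beta_reduce
      omega
    · intro _
      constructor
      · have := opts_card (F2 D0 c x u hux.symm m2) (S1 D0 c u x p hux m2 hup m4 hxp)
        omega
      · intro b1 _ b2 _
        have := opts_card (F2 (insert (u, x) (insert (x, u) D0)) (upd (upd c x u b2) u x b1)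
          p u hup.symm m4') (S2 (insert (u, x) (insert (x, u) D0)) (upd (upd c x u b2) u x b1)
          u p hup m4')
        beta_reduce
        omega
    · intro h; exact absurd h hpr
    · intro b1 h1 b2 h2 a1 h3 a2 h4
      have v1 := v0.extend m2 hux.symm hxr h2
      have v2 := v1.extend m1' hux hur (by rw [opts_ins b2 hne hne.symm]; exact h1)
      have v3 := v2.extend m3' hup hur h3
      have v4 := v3.extend m4'' hup.symm hpr (by rw [opts_ins a1 hnp.symm hnp]; exact h4)
      apply v4.congr
      · ext ⟨a, b⟩
        simp only [D0, mem_insert, mem_erase, mem_univ, and_true, ne_eq, iff_true]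
        tauto
      · rfl

lemma pair_card (O1 O2 : Finset (Fin K)) (m : ℕ) (h1 : m + 1 ≤ O1.card) :
    O2.card * m ≤ ((O1 ×ˢ O2).filter (fun b => b.1 ≠ b.2)).card := by
  have e : ((O1 ×ˢ O2).filter (fun b => b.1 ≠ b.2)).card
      = (O2.sigma (fun b => O1.erase b)).card := by
    apply Finset.card_bij (fun (b : Fin K × Fin K) _ => (⟨b.2, b.1⟩ : Σ _ : Fin K, Fin K))
    · intro b hb
      simp only [mem_filter, mem_product, mem_sigma, mem_erase] at hb ⊢
      tauto
    · rintro ⟨a, b⟩ _ ⟨a', b'⟩ _ h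
      simp only [Sigma.mk.injEq, heq_eq_eq] at h
      rw [h.1, h.2]
    · rintro ⟨a, b⟩ h
      simp only [mem_sigma, mem_erase] at h
      exact ⟨(b, a), by simp only [mem_filter, mem_product]; tauto, rfl⟩
  rw [e, Finset.card_sigma, ← smul_eq_mul]
  apply Finset.card_nsmul_le_sum
  intro b _
  have := Finset.pred_card_le_card_erase (s := O1) (a := b)
  omega

lemma swap_unique {M M' : Multiset (Fin K)} {b1 b2 b1' b2' : Fin K} (h : b1 ≠ b2)
    (e : b1 ::ₘ M = b2 ::ₘ M') (e' : b1' ::ₘ M = b2' ::ₘ M') :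
    b1 = b1' ∧ b2 = b2' := by
  have key : b1 = b1' := by
    by_contra hne
    have h1 := congrArg (Multiset.count b1) e
    have h2 := congrArg (Multiset.count b1) e'
    rw [Multiset.count_cons_self, Multiset.count_cons_of_ne h] at h1
    rw [Multiset.count_cons_of_ne hne, Multiset.count_cons] at h2
    omega
  refine ⟨key, ?_⟩
  subst key
  rw [e] at e'
  exact (Multiset.cons_inj_left M').1 e'

lemma filter_two {β : Type*} [DecidableEq β] (B : Finset β) (E F : β → Prop)
    [DecidablePred E] [DecidablePred F]
    (hE : ∀ b ∈ B, ∀ b' ∈ B, E b → E b' → b = b') (hF : ∀ b ∈ B, ∀ b' ∈ B, F b → F b' → b = b') :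
    B.card ≤ (B.filter (fun b => ¬ E b ∧ ¬ F b)).card + 2 := by
  have h1 : (B.filter E).card ≤ 1 := by
    rw [Finset.card_le_one]
    intro a ha b hb
    rw [mem_filter] at ha hb
    exact hE a ha.1 b hb.1 ha.2 hb.2
  have h2 : (B.filter F).card ≤ 1 := by
    rw [Finset.card_le_one]
    intro a ha b hb
    rw [mem_filter] at ha hb
    exact hF a ha.1 b hb.1 ha.2 hb.2
  have h3 : B ⊆ (B.filter (fun b => ¬ E b ∧ ¬ F b)) ∪ (B.filter E ∪ B.filter F) := by
    intro b hb
    simp only [mem_union, mem_filter]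
    tauto
  have h4 := Finset.card_le_card h3
  have h5 := Finset.card_union_le (B.filter (fun b => ¬ E b ∧ ¬ F b)) (B.filter E ∪ B.filter F)
  have h6 := Finset.card_union_le (B.filter E) (B.filter F)
  omega

end recol
end MDC

namespace MDC
open Finset

section step
variable {V : Type*} [Fintype V] [DecidableEq V] {K : ℕ}
variable (G : SimpleGraph V) [DecidableRel G.Adj]

/-- colors of arcs from `w` to vertices not before `u` -/
def outpal (o : V → ℚ) (u : V) (c : V → V → Fin K) (w : V) : Multiset (Fin K) :=
  outM G (univ.filter (fun a => o u ≤ o a.2)) c w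

/-- colors of arcs to `w` from vertices not before `u` -/
def inpal (o : V → ℚ) (u : V) (c : V → V → Fin K) (w : V) : Multiset (Fin K) :=
  inM G (univ.filter (fun a => o u ≤ o a.1)) c w

/-- first and last neighbors -/
structure Sel (o : V → ℚ) (p g : V → V) : Prop where
  padj : ∀ u, G.Adj u (p u)
  pmin : ∀ u y, G.Adj u y → o (p u) ≤ o y
  gadj : ∀ u, G.Adj u (g u)
  gmax : ∀ u y, G.Adj u y → o y ≤ o (g u)

/-- vertices which need colors of their own -/
def Active (r : V) (o : V → ℚ) (g : V → V) (u : V) : Prop :=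
  u ≠ r ∧ (∀ y, G.Adj y u → o y < o u → g y ≠ u) ∧ o u < o (g u)

/-- `u` is distinguished from later neighbors of its parent -/
def Dist (o : V → ℚ) (p g : V → V) (c : V → V → Fin K) (u : V) : Prop :=
  ∀ u', o u < o u' → G.Adj (p u) u' →
    (outpal G o u c u ≠ outpal G o u c u' ∨ inpal G o u c u ≠ inpal G o u c u') ∨
    (u' ≠ g (p u) ∧ (c (p u) u ≠ c (p u) u' ∨ c u (p u) ≠ c u' (p u)))

variable {G}

lemma recol_same {c : V → V → Fin K} {u x p : V} {b1 b2 a1 a2 : Fin K} {a b : V}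
    (h1 : ¬ (a = u ∧ b = x)) (h2 : ¬ (a = x ∧ b = u)) (h3 : ¬ (a = u ∧ b = p))
    (h4 : ¬ (a = p ∧ b = u)) : recol c u x p b1 b2 a1 a2 a b = c a b := by
  unfold recol upd
  rw [if_neg h4, if_neg h3, if_neg h1, if_neg h2]

lemma recol_from {c : V → V → Fin K} {u x p : V} {b1 b2 a1 a2 : Fin K} {b : V}
    (h1 : b ≠ x) (h2 : b ≠ p) :
    recol c u x p b1 b2 a1 a2 u b = c u b := by
  apply recol_same <;> grind

lemma recol_to {c : V → V → Fin K} {u x p : V} {b1 b2 a1 a2 : Fin K} {a : V}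
    (h1 : a ≠ x) (h2 : a ≠ p) :
    recol c u x p b1 b2 a1 a2 a u = c a u := by
  apply recol_same <;> grind

lemma recol_off {c : V → V → Fin K} {u x p : V} {b1 b2 a1 a2 : Fin K} {a b : V}
    (h1 : a ≠ u) (h2 : b ≠ u) :
    recol c u x p b1 b2 a1 a2 a b = c a b := by
  apply recol_same <;> grind

lemma recol_fst {c : V → V → Fin K} {u x p : V} {b1 b2 a1 a2 : Fin K} {a b : V}
    (h1 : a ≠ u) (h2 : a ≠ x) (h3 : a ≠ p) :
    recol c u x p b1 b2 a1 a2 a b = c a b := by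
  apply recol_same <;> grind

lemma recol_snd {c : V → V → Fin K} {u x p : V} {b1 b2 a1 a2 : Fin K} {a b : V}
    (h1 : b ≠ u) (h2 : b ≠ x) (h3 : b ≠ p) :
    recol c u x p b1 b2 a1 a2 a b = c a b := by
  apply recol_same <;> grind

lemma step {t : ℕ} {r : V} {c0 : V → Fin K} {c : V → V → Fin K} (hK : K = t + 4)
    (ht : 2 ≤ t) (hΔ : ∀ v, G.degree v ≤ t ^ 4)
    (hδ : ∀ v, 2 ≤ G.degree v) (hP : ∀ α, 2 * (Pal G r c0).count α + 2 ≤ G.degree r)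
    (hq : ∀ α, (Pal G r c0).count α + 2 * t ≤ t ^ 3)
    {o : V → ℚ} (ho : GoodOrd G r o) {p g : V → V} (hs : Sel G o p g)
    (hv : Valid G r c0 univ c) {u : V} (hu : Active G r o g u) :
    ∃ c', Valid G r c0 univ c' ∧ Dist G o p g c' u ∧
      ∀ a b, ¬ (a = u ∧ b = g u) → ¬ (a = g u ∧ b = u) → ¬ (a = u ∧ b = p u) →
        ¬ (a = p u ∧ b = u) → c' a b = c a b := by
  obtain ⟨hur, hcl, hfw⟩ := hu
  have hpu : o (p u) < o u := by
    obtain ⟨y, hy, hyu⟩ := ho.back u hur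
    exact lt_of_le_of_lt (hs.pmin u y hy) hyu
  have hux := hs.gadj u
  have hup := hs.padj u
  have hxp : g u ≠ p u := by
    intro h; rw [h] at hfw; exact lt_asymm hfw hpu
  have hxr : g u ≠ r := by
    intro h
    have := ho.root u hur
    rw [h] at hfw
    exact lt_asymm hfw this
  obtain ⟨O1, O2, O3, O4, c1, c3, cn, cr, hval⟩ :=
    core hK hδ hP hv hux hup hxp hur hxr
  have hne : u ≠ g u := hux.ne
  have hnp : u ≠ p u := hup.ne
  generalize hx : g u = x at *
  generalize hpp : p u = q at *
  generalize hsd : g q = s at *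
  let Do : Finset (V × V) := univ.filter (fun a => o u ≤ o a.2)
  let Di : Finset (V × V) := univ.filter (fun a => o u ≤ o a.1)
  let Mo := outM G (Do.erase (u, x)) c u
  let Mi := inM G (Di.erase (x, u)) c u
  let Xo := outM G (Do.erase (x, u)) c x
  let B0 := (O1 ×ˢ O2).filter (fun b => b.1 ≠ b.2)
  let E : Fin K × Fin K → Prop := fun b =>
    b.1 ::ₘ Mo = outpal G o u c s ∧ b.2 ::ₘ Mi = inpal G o u c s
  let F : Fin K × Fin K → Prop := fun b => b.1 ::ₘ Mo = b.2 ::ₘ Xo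
  let bad : V → Fin K × Fin K → Prop := fun w b =>
    b.1 ::ₘ Mo = outpal G o u c w ∧ b.2 ::ₘ Mi = inpal G o u c w
  have hbad : ∀ w b b', bad w b → bad w b' → b = b' := by
    rintro w b b' ⟨h1, h2⟩ ⟨h3, h4⟩
    apply Prod.ext
    · exact (Multiset.cons_inj_left Mo).1 (h1.trans h3.symm)
    · exact (Multiset.cons_inj_left Mi).1 (h2.trans h4.symm)
  classical
  let B := B0.filter (fun b => ¬ E b ∧ ¬ F b)
  have hB : B0.card ≤ B.card + 2 := by
    apply filter_two
    · intro b _ b' _ h h'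
      exact hbad s b b' h h'
    · intro b hb b' _ h h'
      have h1 : b.1 ≠ b.2 := (mem_filter.1 hb).2
      have := swap_unique h1 h h'
      exact Prod.ext this.1 this.2
  have hB0 : O2.card * t ≤ B0.card := pair_card O1 O2 t c1
  let A : Fin K × Fin K → Finset (Fin K × Fin K) := fun b => O3 b.1 b.2 ×ˢ O4 b.1 b.2
  let R : Finset V := univ.filter (fun w => o u < o w ∧ G.Adj q w ∧ (q = r → c r w = c r u))
  have hBm : ∀ b ∈ B, b.1 ∈ O1 ∧ b.2 ∈ O2 ∧ ¬ E b ∧ ¬ F b := by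
    intro b hb
    have h1 := mem_filter.1 hb
    have h2 := mem_product.1 (mem_filter.1 h1.1).1
    exact ⟨h2.1, h2.2, h1.2⟩
  have hpick : ∃ b ∈ B, ∃ a ∈ A b, ∀ w ∈ R, bad w b → (fun w => (c w q, c q w)) w ≠ a := by
    by_cases hqr : q = r
    · obtain ⟨d1, d2⟩ := cr hqr
      apply pick B A t _ R bad hbad
      · have h1 : R.card + 1 ≤ (Pal G r c0).count (c r u) := by
          have h2 : (Pal G r c0).count (c r u)
              = ((G.neighborFinset r).filter (fun w => c r w = c r u)).card := by
            rw [← count_outM]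
            congr 1
            unfold outM Pal
            rw [Finset.filter_true_of_mem (by simp)]
            apply Multiset.map_congr rfl
            intro v _
            exact (hv.root v).symm
          rw [h2]
          apply Finset.card_lt_card
          rw [Finset.ssubset_iff_of_subset]
          · refine ⟨u, ?_, ?_⟩
            · rw [mem_filter, G.mem_neighborFinset, ← hqr]
              exact ⟨hup.symm, rfl⟩
            · simp [R]
          · intro w hw
            have h3 := (mem_filter.1 hw).2
            rw [mem_filter, G.mem_neighborFinset]
            exact ⟨hqr ▸ h3.2.1, h3.2.2 hqr⟩
        have h4 := hq (c r u)
        have h5 : t * t ≤ O2.card * t := Nat.mul_le_mul_right _ d1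
        have h6 : t * t ≤ B.card + 2 := by omega
        have h7 : t * t * t ≤ (B.card + 2) * t := Nat.mul_le_mul_right _ h6
        rw [add_mul] at h7
        have h8 : t ^ 3 = t * t * t := by ring
        omega
      · intro b hb
        obtain ⟨e1, e2, -⟩ := hBm b hb
        have := c3 b.1 e1 b.2 e2
        simp only [A, d2, Finset.card_product, card_singleton, mul_one]
        exact this
    · obtain ⟨d1, d2⟩ := cn hqr
      apply pick B A (t * t) _ R bad hbad
      · have h1 : R.card + 1 ≤ G.degree q := by
          rw [← G.card_neighborFinset_eq_degree]
          apply Finset.card_lt_card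
          rw [Finset.ssubset_iff_of_subset]
          · refine ⟨u, ?_, ?_⟩
            · rw [G.mem_neighborFinset]
              exact hup.symm
            · simp [R]
          · intro w hw
            have h3 := (mem_filter.1 hw).2
            rw [G.mem_neighborFinset]
            exact h3.2.1
        have h4 := hΔ q
        have h5 : (t + 1) * t ≤ O2.card * t := Nat.mul_le_mul_right _ d1
        have h6 : t * t ≤ B.card := by
          rw [add_mul] at h5; omega
        have h7 : t * t * (t * t) ≤ B.card * (t * t) := Nat.mul_le_mul_right _ h6
        have h8 : t ^ 4 = t * t * (t * t) := by ring
        omega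
      · intro b hb
        obtain ⟨e1, e2, -⟩ := hBm b hb
        simp only [A, Finset.card_product]
        exact Nat.mul_le_mul (c3 b.1 e1 b.2 e2) (d2 b.1 e1 b.2 e2)
  obtain ⟨⟨b1, b2⟩, hb, ⟨a1, a2⟩, ha, hR⟩ := hpick
  obtain ⟨e1, e2, hE, hF⟩ := hBm _ hb
  have ha' := mem_product.1 ha
  refine ⟨recol c u x q b1 b2 a1 a2, hval b1 e1 b2 e2 a1 ha'.1 a2 ha'.2, ?_, ?_⟩
  swap
  · intro a b h1 h2 h3 h4
    exact recol_same h1 h2 h3 h4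
  have k1 : recol c u x q b1 b2 a1 a2 u x = b1 := by
    simp [recol, upd, hxp, hnp]
  have k2 : recol c u x q b1 b2 a1 a2 x u = b2 := by
    simp [recol, upd, hxp, hne.symm]
  have k3 : recol c u x q b1 b2 a1 a2 u q = a1 := by
    simp [recol, upd, hnp]
  have k4 : recol c u x q b1 b2 a1 a2 q u = a2 := by
    simp [recol, upd]
  have pu_out : outpal G o u (recol c u x q b1 b2 a1 a2) u = b1 ::ₘ Mo := by
    unfold outpal
    rw [outM_cons hux (by simp [hfw.le]), k1]
    congr 1
    apply outM_congr (fun _ _ => Iff.rfl)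
    intro w _ hw
    simp only [mem_erase, mem_filter, mem_univ, true_and, ne_eq, Prod.mk.injEq] at hw
    have : w ≠ q := by rintro rfl; exact absurd hpu (not_lt.2 hw.2)
    exact recol_from (fun h => hw.1 (by simp [h])) this
  have pu_in : inpal G o u (recol c u x q b1 b2 a1 a2) u = b2 ::ₘ Mi := by
    unfold inpal
    rw [inM_cons hux (by simp [hfw.le]), k2]
    congr 1
    apply inM_congr (fun _ _ => Iff.rfl)
    intro w _ hw
    simp only [mem_erase, mem_filter, mem_univ, true_and, ne_eq, Prod.mk.injEq] at hw
    have : w ≠ q := by rintro rfl; exact absurd hpu (not_lt.2 hw.2)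
    exact recol_to (fun h => hw.1 (by simp [h])) this
  have px_out : outpal G o u (recol c u x q b1 b2 a1 a2) x = b2 ::ₘ Xo := by
    unfold outpal
    rw [outM_cons hux.symm (by simp), k2]
    congr 1
    apply outM_congr (fun _ _ => Iff.rfl)
    intro w _ hw
    simp only [mem_erase, mem_filter, mem_univ, true_and, ne_eq, Prod.mk.injEq] at hw
    exact recol_off hne.symm (fun h => hw.1 (by simp [h]))
  have pw_out : ∀ w, w ≠ u → w ≠ x → w ≠ q →
      outpal G o u (recol c u x q b1 b2 a1 a2) w = outpal G o u c w := by
    intro w h1 h2 h3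
    apply outM_congr (fun _ _ => Iff.rfl)
    intro y _ _
    exact recol_fst h1 h2 h3
  have pw_in : ∀ w, w ≠ u → w ≠ x → w ≠ q →
      inpal G o u (recol c u x q b1 b2 a1 a2) w = inpal G o u c w := by
    intro w h1 h2 h3
    apply inM_congr (fun _ _ => Iff.rfl)
    intro y _ _
    exact recol_snd h1 h2 h3
  intro u' huu' hadj
  rw [hpp] at hadj ⊢
  rw [hsd]
  have n1 : u' ≠ u := by rintro rfl; exact lt_irrefl _ huu'
  have n2 : u' ≠ q := hadj.ne'
  by_cases n3 : u' = x
  · subst n3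
    left; left
    rw [pu_out, px_out]
    exact hF
  rw [pu_out, pu_in, pw_out u' n1 n3 n2, pw_in u' n1 n3 n2, k3, k4]
  by_cases n4 : u' = s
  · subst n4
    left
    by_contra hcon
    push Not at hcon
    exact hE hcon
  by_cases hbd : bad u' (b1, b2)
  swap
  · left
    by_contra hcon
    push Not at hcon
    exact hbd hcon
  right
  refine ⟨n4, ?_⟩
  have s1 : recol c u x q b1 b2 a1 a2 q u' = c q u' := by
    exact recol_off hnp.symm n1
  have s2 : recol c u x q b1 b2 a1 a2 u' q = c u' q := by
    exact recol_off n1 hnp.symm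
  rw [s1, s2]
  by_cases hm : u' ∈ R
  · have h1 := hR u' hm hbd
    by_contra hcon
    push Not at hcon
    apply h1
    exact Prod.ext hcon.2.symm hcon.1.symm
  · left
    have h1 : q = r ∧ c r u' ≠ c r u := by
      by_contra hcon
      apply hm
      simp only [R, mem_filter, mem_univ, true_and]
      refine ⟨huu', hadj, ?_⟩
      intro h
      by_contra h2
      exact hcon ⟨h, h2⟩
    have h2 := ha'.2
    rw [(cr h1.1).2] at h2
    have h3 : a2 = c r u := mem_singleton.1 h2
    rw [h3, h1.1]
    exact h1.2.symm

lemma persist {r : V} {c c' : V → V → Fin K} {o : V → ℚ} (ho : GoodOrd G r o)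
    {p g : V → V} (hs : Sel G o p g) {u v : V} (hur : u ≠ r)
    (hsame : ∀ a b, ¬ (a = u ∧ b = g u) → ¬ (a = g u ∧ b = u) → ¬ (a = u ∧ b = p u) →
        ¬ (a = p u ∧ b = u) → c' a b = c a b)
    (hvA : Active G r o g v) (huv : o u < o v) (hd : Dist G o p g c v) :
    Dist G o p g c' v := by
  have hpu : o (p u) < o u := by
    obtain ⟨y, hy, hyu⟩ := ho.back u hur
    exact lt_of_le_of_lt (hs.pmin u y hy) hyu
  have hs2 : ∀ a b, a ≠ u → b ≠ u → c' a b = c a b := by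
    intro a b h1 h2
    apply hsame <;> tauto
  have ne_of : ∀ w, o u < o w → w ≠ u := by
    rintro w h rfl; exact lt_irrefl _ h
  have ho' : ∀ w, o u < o w → outpal G o v c' w = outpal G o v c w := by
    intro w hw
    apply outM_congr (fun _ _ => Iff.rfl)
    intro y _ hy
    simp only [mem_filter, mem_univ, true_and] at hy
    exact hs2 _ _ (ne_of w hw) (ne_of y (lt_of_lt_of_le huv hy))
  have hi' : ∀ w, o u < o w → inpal G o v c' w = inpal G o v c w := by
    intro w hw
    apply inM_congr (fun _ _ => Iff.rfl)
    intro y _ hy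
    simp only [mem_filter, mem_univ, true_and] at hy
    exact hs2 _ _ (ne_of y (lt_of_lt_of_le huv hy)) (ne_of w hw)
  intro u' huu' hadj
  have huu : o u < o u' := huv.trans huu'
  rw [ho' v huv, ho' u' huu, hi' v huv, hi' u' huu]
  rcases hd u' huu' hadj with h | ⟨h1, h2⟩
  · exact Or.inl h
  right
  refine ⟨h1, ?_⟩
  by_cases hpv : p v = u
  · rw [hpv] at h1 h2 hadj ⊢
    have hvx : v ≠ g u := by
      intro h
      have h3 : G.Adj u v := by rw [← hpv]; exact (hs.padj v).symm
      exact hvA.2.1 u h3 huv h.symm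
    have hvp : v ≠ p u := by
      rintro h; rw [← h] at hpu; exact lt_asymm hpu huv
    have hup : u' ≠ p u := by
      rintro h; rw [← h] at hpu; exact lt_asymm hpu huu
    have n1 := ne_of v huv
    have n2 := ne_of u' huu
    rw [hsame u v, hsame v u, hsame u u', hsame u' u]
    · exact h2
    all_goals tauto
  · rw [hs2 _ _ hpv (ne_of v huv), hs2 _ _ hpv (ne_of u' huu), hs2 _ _ (ne_of v huv) hpv,
      hs2 _ _ (ne_of u' huu) hpv]
    exact h2

lemma all_dist {t : ℕ} {r : V} {c0 : V → Fin K} (hK : K = t + 4)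
    (ht : 2 ≤ t) (hΔ : ∀ v, G.degree v ≤ t ^ 4)
    (hδ : ∀ v, 2 ≤ G.degree v) (hP : ∀ α, 2 * (Pal G r c0).count α + 2 ≤ G.degree r)
    (hq : ∀ α, (Pal G r c0).count α + 2 * t ≤ t ^ 3)
    {o : V → ℚ} (ho : GoodOrd G r o) {p g : V → V} (hs : Sel G o p g) (n : ℕ) :
    ∀ T : Finset V, T.card = n → (∀ v ∈ T, ∀ w, o v < o w → w ∈ T) →
      ∃ c, Valid G r c0 univ c ∧ ∀ v ∈ T, Active G r o g v → Dist G o p g c v := by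
  induction n with
  | zero =>
    intro T hT _
    obtain ⟨c, hc⟩ := exists_valid (G := G) (r := r) (c0 := c0) (by omega) hδ
      (fun α => by have := hP α; omega)
    refine ⟨c, hc, ?_⟩
    rw [Finset.card_eq_zero] at hT
    subst hT
    simp
  | succ n ih =>
    intro T hT hup
    obtain ⟨m, hm, hmin⟩ := Finset.exists_min_image T o (Finset.card_pos.1 (by omega))
    have hlt : ∀ v ∈ T.erase m, o m < o v := by
      intro v hv
      rw [mem_erase] at hv
      exact lt_of_le_of_ne (hmin v hv.2) (fun h => hv.1 (ho.inj h).symm)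
    obtain ⟨c, hc, hcd⟩ := ih (T.erase m) (by rw [Finset.card_erase_of_mem hm]; omega) (by
      intro v hv w hw
      rw [mem_erase]
      constructor
      · rintro rfl
        exact lt_asymm hw (hlt v hv)
      · exact hup v (mem_of_mem_erase hv) w hw)
    by_cases hA : Active G r o g m
    · obtain ⟨c', h1, h2, h3⟩ := step hK ht hΔ hδ hP hq ho hs hc hA
      refine ⟨c', h1, ?_⟩
      intro v hv hvA
      by_cases hvm : v = m
      · subst hvm; exact h2
      · have hve := mem_erase.2 ⟨hvm, hv⟩
        exact persist ho hs hA.1 h3 hvA (hlt v hve) (hcd v hve hvA)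
    · refine ⟨c, hc, ?_⟩
      intro v hv hvA
      by_cases hvm : v = m
      · subst hvm; exact absurd hvA hA
      · exact hcd v (mem_erase.2 ⟨hvm, hv⟩) hvA

lemma final {r : V} {c0 : V → Fin K} {c : V → V → Fin K} {o : V → ℚ} (ho : GoodOrd G r o)
    (hvi : ∀ z, ¬ Viol G o z) {p g : V → V} (hs : Sel G o p g) (hv : Valid G r c0 univ c)
    (hd : ∀ v, Active G r o g v → Dist G o p g c v) {φ : G ≃g G} (hφ : Pres G c φ) :
    ∀ x, φ x = x := by
  by_contra hcon
  push Not at hcon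
  obtain ⟨x, hx⟩ := hcon
  obtain ⟨u, hu, hmin⟩ := Finset.exists_min_image (univ.filter (fun x => φ x ≠ x)) o
    ⟨x, by simp [hx]⟩
  simp only [mem_filter, mem_univ, true_and] at hu hmin
  have hfix : ∀ y, o y < o u → φ y = y := by
    intro y hy
    by_contra h
    exact absurd hy (not_lt.2 (hmin y h))
  have hlt : o u < o (φ u) := by
    rcases lt_trichotomy (o u) (o (φ u)) with h | h | h
    · exact h
    · exact absurd (ho.inj h).symm hu
    · exact absurd (φ.injective (hfix _ h)) hu
  have hur : u ≠ r := by
    rintro rfl; exact hu (hv.fix_root hφ)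
  have hiff : ∀ y, o u ≤ o (φ y) ↔ o u ≤ o y := by
    intro y
    rw [← not_lt, ← not_lt, not_iff_not]
    constructor
    · intro h
      have := φ.injective (hfix _ h)
      rwa [this] at h
    · intro h
      rwa [hfix _ h]
  by_cases hcl : ∀ y, G.Adj y u → o y < o u → g y ≠ u
  · by_cases hfw : o u < o (g u)
    · have hpu : o (p u) < o u := by
        obtain ⟨y, hy, hyu⟩ := ho.back u hur
        exact lt_of_le_of_lt (hs.pmin u y hy) hyu
      have hfp := hfix _ hpu
      have hadj : G.Adj (p u) (φ u) := by
        have := φ.map_adj_iff.2 (hs.padj u).symm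
        rwa [hfp] at this
      rcases hd u ⟨hur, hcl, hfw⟩ (φ u) hlt hadj with (h | h) | ⟨-, h | h⟩
      · apply h
        symm
        apply outM_map hφ
        intro v _
        simp only [mem_filter, mem_univ, true_and]
        exact hiff v
      · apply h
        symm
        apply inM_map hφ
        intro v _
        simp only [mem_filter, mem_univ, true_and]
        exact hiff v
      · apply h
        have := hφ (p u) u (hs.padj u).symm
        rw [hfp] at this
        exact this.symm
      · apply h
        have := hφ u (p u) (hs.padj u)
        rw [hfp] at this
        exact this.symm
    · have hb : ∀ y, G.Adj u y → o y < o u := by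
        intro y hy
        refine lt_of_le_of_ne ((hs.gmax u y hy).trans (not_lt.1 hfw)) ?_
        intro h
        have := ho.inj h
        subst this
        exact G.irrefl hy
      apply hvi u
      refine ⟨⟨φ u, hlt, ?_⟩, hb⟩
      intro y
      constructor
      · intro hy
        have h1 := φ.map_adj_iff.2 hy
        rwa [hfix y (hb y hy)] at h1
      · intro hy
        obtain ⟨z, rfl⟩ := φ.surjective y
        have h1 : G.Adj u z := φ.map_adj_iff.1 hy
        rwa [hfix z (hb z h1)]
  · push Not at hcl
    obtain ⟨y, hyu, hlt', hg⟩ := hcl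
    have h1 := φ.map_adj_iff.2 hyu
    rw [hfix y hlt'] at h1
    have h2 := hs.gmax y _ h1
    rw [hg] at h2
    exact absurd hlt (not_lt.2 h2)

lemma exists_sel (o : V → ℚ) (hδ : ∀ v, 2 ≤ G.degree v) : ∃ p g, Sel G o p g := by
  have hne : ∀ u, (G.neighborFinset u).Nonempty := by
    intro u
    rw [← Finset.card_pos, G.card_neighborFinset_eq_degree]
    have := hδ u
    omega
  choose p hp1 hp2 using fun u => Finset.exists_min_image (G.neighborFinset u) o (hne u)
  choose g hg1 hg2 using fun u => Finset.exists_max_image (G.neighborFinset u) o (hne u)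
  refine ⟨p, g, ?_, ?_, ?_, ?_⟩
  · intro u; simpa using hp1 u
  · intro u y hy; exact hp2 u y (by simpa using hy)
  · intro u; simpa using hg1 u
  · intro u y hy; exact hg2 u y (by simpa using hy)

lemma bal_half {t K d q : ℕ} (hK : K = t + 4) (ht : 2 ≤ t) (hd : 2 ≤ d)
    (h : K * q ≤ d + (K - 1)) : 2 * q ≤ d := by
  subst hK
  rcases Nat.lt_or_ge q 2 with h1 | h1
  · omega
  · obtain ⟨k, rfl⟩ := Nat.exists_eq_add_of_le h1
    have h2 : 2 * k ≤ t * k := Nat.mul_le_mul_right _ ht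
    have h3 : (t + 4) * (2 + k) = 2 * t + t * k + 8 + 4 * k := by ring
    omega

lemma bal_half2 {t K d q : ℕ} (hK : K = t + 4) (ht : 2 ≤ t) (hd : 4 ≤ d)
    (h : K * q ≤ d + (K - 1)) : 2 * q + 2 ≤ d := by
  subst hK
  rcases Nat.lt_or_ge q 2 with h1 | h1
  · omega
  · obtain ⟨k, rfl⟩ := Nat.exists_eq_add_of_le h1
    have h2 : 2 * k ≤ t * k := Nat.mul_le_mul_right _ ht
    have h3 : (t + 4) * (2 + k) = 2 * t + t * k + 8 + 4 * k := by ring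
    omega

lemma bal_cube {t K d q : ℕ} (hK : K = t + 4) (ht : 2 ≤ t) (hd : d ≤ t ^ 4)
    (h : K * q ≤ d + (K - 1)) : q + 2 * t ≤ t ^ 3 := by
  subst hK
  by_contra hcon
  have h1 : t ^ 3 + 1 ≤ q + 2 * t := by omega
  have h2 : (t + 4) * (t ^ 3 + 1) ≤ (t + 4) * (q + 2 * t) := Nat.mul_le_mul_left _ h1
  have h3 : (t + 4) * q ≤ t ^ 4 + t + 3 := by omega
  obtain ⟨k, rfl⟩ := Nat.exists_eq_add_of_le ht
  ring_nf at h2 h3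
  nlinarith [sq_nonneg k, pow_pos (show 0 < k + 1 by omega) 3, Nat.zero_le (k^2), Nat.zero_le (k^3)]

/-- the theorem with an integer parameter -/
lemma main_nat {t : ℕ} (hK : K = t + 4) (ht : 2 ≤ t) (hΔ : G.maxDegree ≤ t ^ 4)
    (hconn : G.Connected) (hδ : ∀ v, 2 ≤ G.degree v) :
    ∃ (r : V) (c0 : V → Fin K) (c : V → V → Fin K), Valid G r c0 univ c ∧
      ∀ φ : G ≃g G, Pres G c φ → ∀ x, φ x = x := by
  have := hconn.nonempty
  obtain ⟨r, hr⟩ := G.exists_maximal_degree_vertex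
  obtain ⟨c0, hc0⟩ := balanced (K := K) (by omega) (G.neighborFinset r)
  rw [G.card_neighborFinset_eq_degree] at hc0
  by_cases h4 : 4 ≤ G.degree r
  · have hdeg : ∀ v, G.degree v ≤ t ^ 4 := fun v => (G.degree_le_maxDegree v).trans hΔ
    obtain ⟨o, ho, hvi⟩ := exists_ord G r hconn hδ
    obtain ⟨p, g, hs⟩ := exists_sel (G := G) o hδ
    obtain ⟨c, hc, hcd⟩ := all_dist (c0 := c0) hK ht hdeg hδ
      (fun α => bal_half2 hK ht h4 (hc0 α)) (fun α => bal_cube hK ht (hdeg r) (hc0 α))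
      ho hs _ univ rfl (fun _ _ w _ => mem_univ w)
    exact ⟨r, c0, c, hc, fun φ hφ => final ho hvi hs hc (fun v => hcd v (mem_univ v)) hφ⟩
  · obtain ⟨c, hc⟩ := exists_valid (G := G) (r := r) (c0 := c0) (by omega) hδ
      (fun α => bal_half hK ht (hδ r) (hc0 α))
    refine ⟨r, c0, c, hc, fun φ hφ => hc.small hconn ?_ hφ⟩
    intro v
    have := G.degree_le_maxDegree v
    omega

end step
end MDC

/-- If `G` is a connected graph of minimum degree at least 2, then the symmetric digraph
`↔G` has a majority distinguishing arc coloring with `⌈Δ^(1/4)⌉ + 4` colors: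
for every vertex `u` and color `α`, at most half of the arcs entering `u` and at most half
of the arcs leaving `u` have color `α`, and the only automorphism of `G` preserving the
arc coloring is the identity; that is, `M'_D(↔G) ≤ ⌈Δ^(1/4)⌉ + 4`. -/
theorem majority_distinguishing_arc_coloring_symmetric_digraph {V : Type*} [Fintype V]
    [DecidableEq V] (G : SimpleGraph V) [DecidableRel G.Adj]
    (hconn : G.Connected) (hδ : ∀ v : V, 2 ≤ G.degree v) :
    ∃ c : V → V → Fin (⌈(G.maxDegree : ℝ) ^ ((1 : ℝ) / 4)⌉₊ + 4),
      (∀ u : V, ∀ α : Fin (⌈(G.maxDegree : ℝ) ^ ((1 : ℝ) / 4)⌉₊ + 4),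
        2 * ((G.neighborFinset u).filter (fun v => c v u = α)).card ≤ G.degree u ∧
        2 * ((G.neighborFinset u).filter (fun v => c u v = α)).card ≤ G.degree u) ∧
      (∀ φ : G ≃g G, (∀ u v : V, G.Adj u v → c (φ u) (φ v) = c u v) →
        ∀ x : V, φ x = x) := by
  have hle := Nat.le_ceil ((G.maxDegree : ℝ) ^ ((1 : ℝ) / 4))
  have hnn : (0 : ℝ) ≤ (G.maxDegree : ℝ) := Nat.cast_nonneg _
  have hpow : ((G.maxDegree : ℝ) ^ ((1 : ℝ) / 4)) ^ (4 : ℕ) = G.maxDegree := by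
    rw [← Real.rpow_natCast, ← Real.rpow_mul hnn]
    norm_num
  have hΔ : G.maxDegree ≤ ⌈(G.maxDegree : ℝ) ^ ((1 : ℝ) / 4)⌉₊ ^ 4 := by
    have h1 : ((G.maxDegree : ℝ) ^ ((1 : ℝ) / 4)) ^ (4 : ℕ)
        ≤ (⌈(G.maxDegree : ℝ) ^ ((1 : ℝ) / 4)⌉₊ : ℝ) ^ (4 : ℕ) :=
      pow_le_pow_left₀ (Real.rpow_nonneg hnn _) hle 4
    rw [hpow] at h1
    exact_mod_cast h1
  have ht : 2 ≤ ⌈(G.maxDegree : ℝ) ^ ((1 : ℝ) / 4)⌉₊ := by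
    by_contra hcon
    have h1 : ⌈(G.maxDegree : ℝ) ^ ((1 : ℝ) / 4)⌉₊ ≤ 1 := by omega
    have h2 : ⌈(G.maxDegree : ℝ) ^ ((1 : ℝ) / 4)⌉₊ ^ 4 ≤ 1 ^ 4 := Nat.pow_le_pow_left h1 4
    obtain ⟨v⟩ := hconn.nonempty
    have h3 := hδ v
    have h4 := G.degree_le_maxDegree v
    rw [one_pow] at h2
    omega
  obtain ⟨r, c0, c, hc, hφ⟩ := MDC.main_nat (G := G) rfl ht hΔ hconn hδ
  refine ⟨c, ?_, hφ⟩
  intro u α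
  constructor
  · rw [← MDC.count_inM]; exact hc.inn u α
  · rw [← MDC.count_outM]; exact hc.out u α
end

section
/- Every finite simple graph of minimum degree at least 4 has a majority edge coloring with 3 colors. -/
open SimpleGraph

/-- Majority edge coloring. -/
def IsMajorityEdgeColoring {V : Type*} [Fintype V] [DecidableEq V]
    (G : SimpleGraph V) [DecidableRel G.Adj] {k : ℕ} (c : Sym2 V → Fin k) : Prop :=
  ∀ u : V, ∀ α : Fin k,
    2 * ((G.neighborFinset u).filter (fun v => c s(u, v) = α)).card ≤ G.degree u

/-- merging step: pick a sign so that the sum cancels at `x` -/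
lemma exists_sign_merge {V : Type*} [Fintype V] [DecidableEq V] (a b : V → ℤ) (x : V)
    (W : Finset V) (hx : x ∈ W) (ha : a x ≠ 0) (hb : b x ≠ 0) :
    ∃ σ : ℤ, (σ = 1 ∨ σ = -1) ∧
      ∀ T : Finset V, x ∈ T →
        ∑ y ∈ T, |a y + σ * b y| + 2 ≤ ∑ y ∈ T, |a y| + ∑ y ∈ T, |b y| := by
  obtain ⟨σ, hσ, h⟩ : ∃ σ : ℤ, (σ = 1 ∨ σ = -1) ∧ |a x + σ * b x| + 2 ≤ |a x| + |b x| := by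
    rcases lt_or_gt_of_ne ha with h1 | h1 <;> rcases lt_or_gt_of_ne hb with h2 | h2
    · refine ⟨-1, Or.inr rfl, ?_⟩
      rw [abs_of_neg h1, abs_of_neg h2]
      rcases abs_cases (a x + -1 * b x) with h | h <;> omega
    · refine ⟨1, Or.inl rfl, ?_⟩
      rw [abs_of_neg h1, abs_of_pos h2]
      rcases abs_cases (a x + 1 * b x) with h | h <;> omega
    · refine ⟨1, Or.inl rfl, ?_⟩
      rw [abs_of_pos h1, abs_of_neg h2]
      rcases abs_cases (a x + 1 * b x) with h | h <;> omega
    · refine ⟨-1, Or.inr rfl, ?_⟩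
      rw [abs_of_pos h1, abs_of_pos h2]
      rcases abs_cases (a x + -1 * b x) with h | h <;> omega
  refine ⟨σ, hσ, fun T hT => ?_⟩
  have hle : ∑ y ∈ T.erase x, |a y + σ * b y| ≤ ∑ y ∈ T.erase x, (|a y| + |b y|) := by
    apply Finset.sum_le_sum
    intro y _
    refine (abs_add_le _ _).trans ?_
    rw [abs_mul]
    rcases hσ with rfl | rfl <;> simp
  rw [Finset.sum_add_distrib] at hle
  rw [← Finset.add_sum_erase _ _ hT, ← Finset.add_sum_erase _ (fun y => |a y|) hT,
    ← Finset.add_sum_erase _ (fun y => |b y|) hT]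
  linarith

/-- unmerging step -/
lemma unmerge {ι V : Type*} [DecidableEq ι] (s : Finset ι) (v : ι → V → ℤ) (e f : ι)
    (he : e ∈ s) (hf : f ∈ s) (hef : e ≠ f) (σ : ℤ) (hσ : σ = 1 ∨ σ = -1) (ε : ι → ℤ)
    (hε : ∀ i, ε i = 1 ∨ ε i = -1) :
    ∃ ε' : ι → ℤ, (∀ i, ε' i = 1 ∨ ε' i = -1) ∧ ∀ x, ∑ i ∈ s, ε' i * v i x =
      ∑ i ∈ s.erase f, ε i * (Function.update v e (fun y => v e y + σ * v f y)) i x := by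
  refine ⟨Function.update ε f (σ * ε e), ?_, ?_⟩
  · intro i
    by_cases h : i = f
    · subst h
      simp only [Function.update_self]
      rcases hσ with rfl | rfl <;> rcases hε e with h | h <;> simp [h]
    · simp only [Function.update_of_ne h]
      exact hε i
  · intro x
    have he' : e ∈ s.erase f := Finset.mem_erase.2 ⟨hef, he⟩
    rw [← Finset.add_sum_erase _ _ hf, ← Finset.add_sum_erase _ _ he',
      ← Finset.add_sum_erase (s.erase f) _ he']
    have : ∑ i ∈ (s.erase f).erase e, Function.update ε f (σ * ε e) i * v i x =
        ∑ i ∈ (s.erase f).erase e,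
          ε i * (Function.update v e (fun y => v e y + σ * v f y)) i x := by
      apply Finset.sum_congr rfl
      intro i hi
      simp only [Finset.mem_erase] at hi
      rw [Function.update_of_ne hi.2.1, Function.update_of_ne hi.1]
    rw [this]
    simp only [Function.update_self, Function.update_of_ne hef]
    ring

/-- Signs exist with all coordinates at most 2. -/
lemma signs_two {ι V : Type*} [DecidableEq ι] [Fintype V] [DecidableEq V] (n : ℕ) :
    ∀ (s : Finset ι) (_ : s.card = n) (v : ι → V → ℤ)
      (_ : ∀ i ∈ s, ∑ y, |v i y| ≤ 2),
    ∃ ε : ι → ℤ, (∀ i, ε i = 1 ∨ ε i = -1) ∧ ∀ x, |∑ i ∈ s, ε i * v i x| ≤ 2 := by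
  induction n with
  | zero =>
    intro s hs v _
    rw [Finset.card_eq_zero] at hs
    subst hs
    exact ⟨fun _ => 1, by simp, by simp⟩
  | succ n ih =>
    intro s hs v hv
    by_cases h : ∃ x, ∃ e ∈ s, ∃ f ∈ s, e ≠ f ∧ v e x ≠ 0 ∧ v f x ≠ 0
    · obtain ⟨x, e, he, f, hf, hef, h1, h2⟩ := h
      obtain ⟨σ, hσ, hm⟩ := exists_sign_merge (v e) (v f) x Finset.univ (Finset.mem_univ x) h1 h2
      obtain ⟨ε, hε, hb⟩ := ih (s.erase f) (by rw [Finset.card_erase_of_mem hf, hs]; rfl)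
        (Function.update v e (fun y => v e y + σ * v f y)) (by
          intro i hi
          by_cases hie : i = e
          · subst hie
            simp only [Function.update_self]
            have := hm Finset.univ (Finset.mem_univ x)
            have := hv i he
            have := hv f hf
            linarith
          · simp only [Function.update_of_ne hie]
            exact hv i (Finset.mem_of_mem_erase hi))
      obtain ⟨ε', h1', h2'⟩ := unmerge s v e f he hf hef σ hσ ε hε
      exact ⟨ε', h1', fun y => by rw [h2']; exact hb y⟩
    · push Not at h
      refine ⟨fun _ => 1, by simp, fun x => ?_⟩
      by_cases hx : ∃ e ∈ s, v e x ≠ 0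
      · obtain ⟨e, he, hex⟩ := hx
        rw [Finset.sum_eq_single_of_mem e he (fun b hb hbe => by
          rw [h x e he b hb (Ne.symm hbe) hex, mul_zero]), one_mul]
        exact (Finset.single_le_sum (f := fun y => |v e y|) (fun i _ => abs_nonneg _)
          (Finset.mem_univ x)).trans (hv e he)
      · push Not at hx
        rw [Finset.sum_eq_zero (fun i hi => by rw [hx i hi, mul_zero])]
        simp

/-- Signs exist with all coordinates at most 2, and at most 1 on `U`. -/
lemma signs_two_one {ι V : Type*} [DecidableEq ι] [Fintype V] [DecidableEq V] (U : Finset V)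
    (n : ℕ) :
    ∀ (s : Finset ι) (_ : s.card = n) (v : ι → V → ℤ)
      (_ : ∀ i ∈ s, ∑ y, |v i y| ≤ 2) (_ : ∀ i ∈ s, ∑ y ∈ U, |v i y| ≤ 1),
    ∃ ε : ι → ℤ, (∀ i, ε i = 1 ∨ ε i = -1) ∧ (∀ x, |∑ i ∈ s, ε i * v i x| ≤ 2) ∧
      ∀ x ∈ U, |∑ i ∈ s, ε i * v i x| ≤ 1 := by
  induction n with
  | zero =>
    intro s hs v _ _
    rw [Finset.card_eq_zero] at hs
    subst hs
    exact ⟨fun _ => 1, by simp, by simp, by simp⟩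
  | succ n ih =>
    intro s hs v hv hU
    by_cases h : ∃ x ∈ U, ∃ e ∈ s, ∃ f ∈ s, e ≠ f ∧ v e x ≠ 0 ∧ v f x ≠ 0
    · obtain ⟨x, hxU, e, he, f, hf, hef, h1, h2⟩ := h
      obtain ⟨σ, hσ, hm⟩ := exists_sign_merge (v e) (v f) x Finset.univ (Finset.mem_univ x) h1 h2
      obtain ⟨ε, hε, hb, hb'⟩ := ih (s.erase f) (by rw [Finset.card_erase_of_mem hf, hs]; rfl)
        (Function.update v e (fun y => v e y + σ * v f y)) (by
          intro i hi
          by_cases hie : i = e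
          · subst hie
            simp only [Function.update_self]
            have := hm Finset.univ (Finset.mem_univ x)
            have := hv i he
            have := hv f hf
            linarith
          · simp only [Function.update_of_ne hie]
            exact hv i (Finset.mem_of_mem_erase hi)) (by
          intro i hi
          by_cases hie : i = e
          · subst hie
            simp only [Function.update_self]
            have := hm U hxU
            have := hU i he
            have := hU f hf
            linarith
          · simp only [Function.update_of_ne hie]
            exact hU i (Finset.mem_of_mem_erase hi))
      obtain ⟨ε', h1', h2'⟩ := unmerge s v e f he hf hef σ hσ ε hε
      exact ⟨ε', h1', fun y => by rw [h2']; exact hb y, fun y hy => by rw [h2']; exact hb' y hy⟩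
    · push Not at h
      obtain ⟨ε, hε, hb⟩ := signs_two (n + 1) s hs v hv
      refine ⟨ε, hε, hb, fun x hxU => ?_⟩
      by_cases hx : ∃ e ∈ s, v e x ≠ 0
      · obtain ⟨e, he, hex⟩ := hx
        rw [Finset.sum_eq_single_of_mem e he (fun b hb hbe => by
          rw [h x hxU e he b hb (Ne.symm hbe) hex, mul_zero])]
        have h1 := (Finset.single_le_sum (f := fun y => |v e y|) (fun i _ => abs_nonneg _)
          hxU).trans (hU e he)
        rw [abs_mul]
        rcases hε e with h | h <;> simpa [h] using h1
      · push Not at hx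
        rw [Finset.sum_eq_zero (fun i hi => by rw [hx i hi, mul_zero])]
        simp

/-- Number of neighbours of `x` joined to `x` by an edge of `C`. -/
def cDeg {V : Type*} [Fintype V] [DecidableEq V] (G : SimpleGraph V) [DecidableRel G.Adj]
    (C : Finset (Sym2 V)) (x : V) : ℕ :=
  ((G.neighborFinset x).filter (fun y => s(x, y) ∈ C)).card

/-- capacity in the Hall argument -/
def capac (d : ℕ) : ℕ := if d % 2 = 1 then d / 2 - 1 else d / 2

/-- Hall: every odd vertex selects a neighbour, no vertex is selected too often. -/
lemma exists_select {V : Type*} [Fintype V] [DecidableEq V]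
    (G : SimpleGraph V) [DecidableRel G.Adj] (hδ : ∀ v : V, 4 ≤ G.degree v) :
    ∃ f : {v : V // G.degree v % 2 = 1} → V, (∀ v, G.Adj v.1 (f v)) ∧
      ∀ x, (Finset.univ.filter (fun v => f v = x)).card ≤ capac (G.degree x) := by
  classical
  let t : {v : V // G.degree v % 2 = 1} → Finset ((_ : V) × ℕ) := fun v =>
    (G.neighborFinset v.1).sigma (fun x => Finset.range (capac (G.degree x)))
  have hall : ∀ T : Finset {v : V // G.degree v % 2 = 1}, T.card ≤ (T.biUnion t).card := by
    intro T
    let N : Finset V := T.biUnion (fun v => G.neighborFinset v.1)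
    have hN : T.biUnion t = N.sigma (fun x => Finset.range (capac (G.degree x))) := by
      ext ⟨x, i⟩
      simp only [t, N, Finset.mem_biUnion, Finset.mem_sigma]
      constructor
      · rintro ⟨v, hv, h1, h2⟩
        exact ⟨⟨v, hv, h1⟩, h2⟩
      · rintro ⟨⟨v, hv, h1⟩, h2⟩
        exact ⟨v, hv, h1, h2⟩
    rw [hN, Finset.card_sigma]
    simp only [Finset.card_range]
    have h5 : 5 * T.card ≤ 5 * ∑ x ∈ N, capac (G.degree x) := by
      calc 5 * T.card = ∑ v ∈ T, 5 := by simp [mul_comm]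
        _ ≤ ∑ v ∈ T, (N.filter (fun x => G.Adj v.1 x)).card := by
            apply Finset.sum_le_sum
            intro v hv
            have : N.filter (fun x => G.Adj v.1 x) = G.neighborFinset v.1 := by
              ext x
              simp only [N, Finset.mem_filter, Finset.mem_biUnion, mem_neighborFinset]
              exact ⟨fun h => h.2, fun h => ⟨⟨v, hv, h⟩, h⟩⟩
            rw [this, card_neighborFinset_eq_degree]
            have := hδ v.1
            have := v.2
            omega
        _ = ∑ x ∈ N, (T.filter (fun v => G.Adj v.1 x)).card :=
            Finset.sum_card_bipartiteAbove_eq_sum_card_bipartiteBelow _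
        _ ≤ ∑ x ∈ N, 5 * capac (G.degree x) := by
            apply Finset.sum_le_sum
            intro x _
            have h1 : (T.filter (fun v => G.Adj v.1 x)).card ≤ G.degree x := by
              rw [← card_neighborFinset_eq_degree]
              apply Finset.card_le_card_of_injOn (fun v => v.1)
              · intro v hv
                simp only [Finset.coe_filter, Set.mem_setOf_eq] at hv
                simpa using hv.2.symm
              · intro a _ b _ h
                exact Subtype.ext h
            have := hδ x
            unfold capac
            split_ifs <;> omega
        _ = _ := by rw [Finset.mul_sum]
    omega
  obtain ⟨g, hg, hgt⟩ := (Finset.all_card_le_biUnion_card_iff_exists_injective t).1 hall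
  refine ⟨fun v => (g v).1, fun v => ?_, fun x => ?_⟩
  · have := hgt v
    simp only [t, Finset.mem_sigma, mem_neighborFinset] at this
    exact this.1
  · rw [← Finset.card_range (capac (G.degree x))]
    apply Finset.card_le_card_of_injOn (fun v => (g v).2)
    · intro v hv
      have hv' : (g v).1 = x := by simpa using hv
      have := hgt v
      simp only [t, Finset.mem_sigma] at this
      rw [← hv']
      exact this.2
    · intro a ha b hb h
      have ha' : (g a).1 = x := by simpa using ha
      have hb' : (g b).1 = x := by simpa using hb
      apply hg
      apply Sigma.ext
      · rw [ha', hb']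
      · exact heq_of_eq h

/-- An edge set covering the odd vertices, with bounded degrees. -/
lemma exists_cover {V : Type*} [Fintype V] [DecidableEq V]
    (G : SimpleGraph V) [DecidableRel G.Adj] (hδ : ∀ v : V, 4 ≤ G.degree v) :
    ∃ C : Finset (Sym2 V), C ⊆ G.edgeFinset ∧
      ∀ x, cDeg G C x ≤ G.degree x / 2 ∧ (G.degree x % 2 = 1 → 1 ≤ cDeg G C x) := by
  classical
  obtain ⟨f, hf, hcap⟩ := exists_select G hδ
  refine ⟨Finset.univ.image (fun v => s(v.1, f v)), ?_, fun x => ⟨?_, ?_⟩⟩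
  · intro e he
    simp only [Finset.mem_image, Finset.mem_univ, true_and] at he
    obtain ⟨v, rfl⟩ := he
    simpa using hf v
  · have hsub : (G.neighborFinset x).filter
        (fun y => s(x, y) ∈ Finset.univ.image (fun v => s(v.1, f v))) ⊆
        ((Finset.univ.filter (fun v => f v = x)).image (fun v => v.1)) ∪
          (if h : G.degree x % 2 = 1 then {f ⟨x, h⟩} else ∅) := by
      intro y hy
      simp only [Finset.mem_filter, Finset.mem_image, Finset.mem_univ, true_and] at hy
      obtain ⟨_, v, hv⟩ := hy
      rw [Finset.mem_union]
      rcases Sym2.eq_iff.1 hv with ⟨h1, h2⟩ | ⟨h1, h2⟩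
      · right
        have hx : G.degree x % 2 = 1 := h1 ▸ v.2
        have : v = ⟨x, hx⟩ := Subtype.ext h1
        rw [dif_pos hx, ← this, h2]
        simp
      · left
        exact Finset.mem_image.2 ⟨v, by simpa using h2, h1⟩
    refine (Finset.card_le_card hsub).trans ((Finset.card_union_le _ _).trans ?_)
    have h1 := (Finset.card_image_le (s := Finset.univ.filter (fun v => f v = x))
      (f := fun v => v.1)).trans (hcap x)
    have := hδ x
    unfold capac at h1
    split_ifs at h1 ⊢ with h
    · simp only [Finset.card_singleton]
      omega
    · simp only [Finset.card_empty]
      omega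
  · intro hx
    apply Finset.card_pos.2
    refine ⟨f ⟨x, hx⟩, ?_⟩
    simp only [Finset.mem_filter, mem_neighborFinset, Finset.mem_image, Finset.mem_univ, true_and]
    exact ⟨hf ⟨x, hx⟩, ⟨x, hx⟩, rfl⟩

lemma cDeg_insert_le {V : Type*} [Fintype V] [DecidableEq V]
    (G : SimpleGraph V) [DecidableRel G.Adj] (C : Finset (Sym2 V)) (a b x : V) :
    cDeg G (insert s(a, b) C) x ≤ cDeg G C x + (if x = a ∨ x = b then 1 else 0) := by
  unfold cDeg
  split_ifs with h
  · have : ∃ z, s(a, b) = s(x, z) := by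
      rcases h with rfl | rfl
      · exact ⟨b, rfl⟩
      · exact ⟨a, Sym2.eq_swap⟩
    obtain ⟨z, hz⟩ := this
    rw [hz]
    refine (Finset.card_le_card (t := insert z ((G.neighborFinset x).filter
      (fun y => s(x, y) ∈ C))) ?_).trans (Finset.card_insert_le _ _)
    intro y hy
    simp only [Finset.mem_filter, Finset.mem_insert] at hy ⊢
    rcases hy with ⟨h1, h2 | h2⟩
    · left
      exact Sym2.congr_right.1 h2
    · exact Or.inr ⟨h1, h2⟩
  · apply Finset.card_le_card
    intro y hy
    simp only [Finset.mem_filter, Finset.mem_insert] at hy ⊢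
    rcases hy with ⟨h1, h2 | h2⟩
    · exfalso
      apply h
      have : x ∈ s(a, b) := by rw [← h2]; exact Sym2.mem_mk_left _ _
      simpa using this
    · exact ⟨h1, h2⟩

/-- A maximal such edge set. -/
lemma exists_maximal_cover {V : Type*} [Fintype V] [DecidableEq V]
    (G : SimpleGraph V) [DecidableRel G.Adj] (hδ : ∀ v : V, 4 ≤ G.degree v) :
    ∃ C : Finset (Sym2 V), 
      (∀ x, cDeg G C x ≤ G.degree x / 2 ∧ (G.degree x % 2 = 1 → 1 ≤ cDeg G C x)) ∧
      ∀ a b, G.Adj a b → s(a, b) ∉ C → 2 ≤ cDeg G C a ∨ 2 ≤ cDeg G C b := by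
  classical
  let F : Finset (Finset (Sym2 V)) := G.edgeFinset.powerset.filter (fun C =>
    ∀ x, cDeg G C x ≤ G.degree x / 2 ∧ (G.degree x % 2 = 1 → 1 ≤ cDeg G C x))
  have hF : F.Nonempty := by
    obtain ⟨C, h1, h2⟩ := exists_cover G hδ
    exact ⟨C, Finset.mem_filter.2 ⟨Finset.mem_powerset.2 h1, h2⟩⟩
  obtain ⟨C, hC, hmax⟩ := Finset.exists_max_image F Finset.card hF
  obtain ⟨hC1, hC2⟩ := Finset.mem_filter.1 hC
  refine ⟨C, hC2, fun a b hab hn => ?_⟩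
  by_contra hcon
  push Not at hcon
  have hin : insert s(a, b) C ∈ F := by
    refine Finset.mem_filter.2 ⟨?_, fun x => ⟨?_, fun hx => ?_⟩⟩
    · rw [Finset.mem_powerset] at hC1 ⊢
      exact Finset.insert_subset (by simpa using hab) hC1
    · have h1 := cDeg_insert_le G C a b x
      have h2 := (hC2 x).1
      have h3 := hδ x
      split_ifs at h1 with h
      · have : cDeg G C x < 2 := by
          rcases h with rfl | rfl
          · exact hcon.1
          · exact hcon.2
        omega
      · omega
    · refine ((hC2 x).2 hx).trans ?_
      apply Finset.card_le_card
      intro y hy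
      simp only [Finset.mem_filter, Finset.mem_insert] at hy ⊢
      exact ⟨hy.1, Or.inr hy.2⟩
  have := hmax _ hin
  rw [Finset.card_insert_of_notMem hn] at this
  omega

/-- Every finite graph of minimum degree at least 4 has a majority edge 3-coloring. -/
theorem majority_three_colors {V : Type*} [Fintype V] [DecidableEq V]
    (G : SimpleGraph V) [DecidableRel G.Adj] (hδ : ∀ v : V, 4 ≤ G.degree v) :
    ∃ c : Sym2 V → Fin 3, IsMajorityEdgeColoring G c := by
  classical
  obtain ⟨C, hC, hmax⟩ := exists_maximal_cover G hδ
  let U : Finset V := Finset.univ.filter (fun x => cDeg G C x ≤ 1)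
  let H : Finset (Sym2 V) := G.edgeFinset \ C
  let v : Sym2 V → V → ℤ := fun e x => if x ∈ e then 1 else 0
  have habs : ∀ e x, |v e x| = if x ∈ e then 1 else 0 := by
    intro e x
    simp only [v]
    split_ifs <;> simp
  obtain ⟨ε, hε, h2, h1⟩ := signs_two_one U H.card H rfl v (by
      intro e _
      simp only [habs]
      rw [Finset.sum_boole]
      induction e with
      | h a b =>
        have : (Finset.univ.filter (fun x => x ∈ s(a, b))) ⊆ {a, b} := by
          intro x hx
          simpa using hx
        exact_mod_cast (Finset.card_le_card this).trans Finset.card_le_two) (by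
      intro e he
      simp only [habs]
      rw [Finset.sum_boole]
      induction e with
      | h a b =>
        obtain ⟨he1, he2⟩ := Finset.mem_sdiff.1 he
        have hab : G.Adj a b := by simpa using he1
        have hle : (U.filter (fun x => x ∈ s(a, b))).card ≤ 1 := by
          rw [Finset.card_le_one]
          intro x hx y hy
          simp only [U, Finset.mem_filter, Finset.mem_univ, true_and, Sym2.mem_iff] at hx hy
          have := hmax a b hab he2
          rcases hx with ⟨hx1, rfl | rfl⟩ <;> rcases hy with ⟨hy1, rfl | rfl⟩ <;>
            first | rfl | omega
        exact_mod_cast hle)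
  refine ⟨fun e => if e ∈ C then 2 else if ε e = 1 then 0 else 1, ?_⟩
  intro x α
  let P := (G.neighborFinset x).filter (fun y => s(x, y) ∉ C ∧ ε s(x, y) = 1)
  let Q := (G.neighborFinset x).filter (fun y => s(x, y) ∉ C ∧ ε s(x, y) ≠ 1)
  let M := (G.neighborFinset x).filter (fun y => s(x, y) ∉ C)
  have hMC : cDeg G C x + M.card = G.degree x := by
    rw [← card_neighborFinset_eq_degree]
    exact Finset.card_filter_add_card_filter_not _
  have hP : M.filter (fun y => ε s(x, y) = 1) = P := Finset.filter_filter _ _ _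
  have hQ : M.filter (fun y => ¬ ε s(x, y) = 1) = Q := Finset.filter_filter _ _ _
  have hPQ : P.card + Q.card = M.card := by
    rw [← hP, ← hQ]
    exact Finset.card_filter_add_card_filter_not _
  have hsum : ∑ e ∈ H, ε e * v e x = (P.card : ℤ) - Q.card := by
    have e1 : ∑ e ∈ H, ε e * v e x = ∑ e ∈ H.filter (fun e => x ∈ e), ε e := by
      rw [Finset.sum_filter]
      apply Finset.sum_congr rfl
      intro e _
      simp only [v]
      split_ifs <;> simp
    have e2 : H.filter (fun e => x ∈ e) = M.image (fun y => s(x, y)) := by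
      ext e
      simp only [H, M, Finset.mem_filter, Finset.mem_sdiff, Finset.mem_image, mem_neighborFinset,
        mem_edgeFinset]
      constructor
      · rintro ⟨⟨h1, h2⟩, h3⟩
        obtain ⟨y, rfl⟩ := Sym2.mem_iff_exists.1 h3
        exact ⟨y, ⟨by simpa using h1, h2⟩, rfl⟩
      · rintro ⟨y, ⟨h1, h2⟩, rfl⟩
        exact ⟨⟨by simpa using h1, h2⟩, by simp⟩
    rw [e1, e2, Finset.sum_image (fun a _ b _ h => Sym2.congr_right.1 h),
      ← Finset.sum_filter_add_sum_filter_not M (fun y => ε s(x, y) = 1), hP, hQ]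
    have e3 : ∑ y ∈ P, ε s(x, y) = ∑ y ∈ P, 1 :=
      Finset.sum_congr rfl (fun y hy => (Finset.mem_filter.1 hy).2.2)
    have e4 : ∑ y ∈ Q, ε s(x, y) = ∑ y ∈ Q, (-1) :=
      Finset.sum_congr rfl (fun y hy => (hε _).resolve_left (Finset.mem_filter.1 hy).2.2)
    rw [e3, e4]
    simp
    ring
  have h2x := h2 x
  have h1x : cDeg G C x ≤ 1 → |∑ e ∈ H, ε e * v e x| ≤ 1 := fun h => h1 x (by simpa [U] using h)
  rw [hsum] at h2x h1x
  rw [abs_le] at h2x h1x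
  obtain ⟨hc1, hc2⟩ := hC x
  have key : 2 * P.card ≤ G.degree x ∧ 2 * Q.card ≤ G.degree x := by
    by_cases hle : cDeg G C x ≤ 1
    · have := h1x hle
      omega
    · omega
  fin_cases α
  · refine le_trans ?_ key.1
    gcongr 2 * ?_
    apply Finset.card_le_card
    intro y hy
    simp only [Finset.mem_filter, P] at hy ⊢
    refine ⟨hy.1, ?_⟩
    have hh := hy.2
    by_cases k1 : s(x, y) ∈ C
    · rw [if_pos k1] at hh
      exact absurd hh (by decide)
    · rw [if_neg k1] at hh
      refine ⟨k1, ?_⟩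
      by_contra k2
      rw [if_neg k2] at hh
      exact absurd hh (by decide)
  · refine le_trans ?_ key.2
    gcongr 2 * ?_
    apply Finset.card_le_card
    intro y hy
    simp only [Finset.mem_filter, Q] at hy ⊢
    refine ⟨hy.1, ?_⟩
    have hh := hy.2
    by_cases k1 : s(x, y) ∈ C
    · rw [if_pos k1] at hh
      exact absurd hh (by decide)
    · rw [if_neg k1] at hh
      refine ⟨k1, fun k2 => ?_⟩
      rw [if_pos k2] at hh
      exact absurd hh (by decide)
  · have : 2 * cDeg G C x ≤ G.degree x := by omega
    refine le_trans ?_ this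
    unfold cDeg
    gcongr 2 * ?_
    apply Finset.card_le_card
    intro y hy
    simp only [Finset.mem_filter] at hy ⊢
    refine ⟨hy.1, ?_⟩
    have hh := hy.2
    by_contra k1
    rw [if_neg k1] at hh
    split_ifs at hh <;> exact absurd hh (by decide)
end
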